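/- Assume 1/4 < s' ≤ 1, 1/2 < s ≤ 1, max(3/2 − 2s, s/2 − 1/8) < s' < 4s − 3/2, 1/2 < θ₀ < 3/4, and max(1/2, 1 − s') < θ₁ < min(3/4, 4s − s' − 1, 2s − 1/2). Then there exists ε₀ > 0 such that for every ε with 0 < ε ≤ ε₀ there exists a constant C > 0 such that for all Schwartz functions u, v on ℝ^{1+2} and all j, k ∈ {1,2}: ‖Q_{jk}(u, D^{−1}v)‖_{H^{s−1, θ₀−1+ε}} ≤ C ‖u‖_{H^{s,θ₀}} ‖v‖_{H^{s',θ₁}}, where D^{−1}v is the tempered distribution whose space-time Fourier transform is |ξ|^{−1} v̂(τ,ξ). -/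

import Mathlib

open MeasureTheory Real
open scoped FourierTransform

noncomputable section

/-- Space-time ℝ^{1+2}: coordinate 0 is time `t`, coordinates 1,2 are space `x₁, x₂`. -/
abbrev SpaceTime := EuclideanSpace ℝ (Fin 3)

/-- The magnitude `|ξ|` of the spatial part of a frequency point `(τ, ξ) ∈ ℝ × ℝ²`. -/
def spFreq (ζ : SpaceTime) : ℝ := Real.sqrt ((ζ 1) ^ 2 + (ζ 2) ^ 2)

/-- The wave-Sobolev norm
`‖u‖_{H^{s,b}} = (∫ (1+|ξ|²)^s (1+||τ|-|ξ||)^{2b} |û(τ,ξ)|² dτ dξ)^{1/2}`. -/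
def waveNorm (s b : ℝ) (f : SpaceTime → ℂ) : ℝ :=
  (∫ ζ : SpaceTime, (1 + (spFreq ζ) ^ 2) ^ s * (1 + |(|ζ 0| - spFreq ζ)|) ^ (2 * b) *
    ‖𝓕 f ζ‖ ^ 2) ^ (1/2 : ℝ)

/-- Partial derivative in the `i`-th coordinate direction. -/
def pd (i : Fin 3) (f : SpaceTime → ℂ) (x : SpaceTime) : ℂ :=
  fderiv ℝ f x (EuclideanSpace.single i 1)

/-- `∂_{x_j}(D^{-1}v)`: the function whose space-time Fourier transform is
`i ξ_j |ξ|^{-1} v̂(τ,ξ)`, realized via the inverse Fourier transform. -/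
def pdDinv (j : Fin 3) (v : SpaceTime → ℂ) : SpaceTime → ℂ :=
  𝓕⁻ (fun ζ : SpaceTime => Complex.I * (ζ j : ℂ) * ((spFreq ζ : ℝ) : ℂ)⁻¹ * 𝓕 v ζ)

open scoped ENNReal

/-- The `L²` norm of an extended nonnegative function. -/
def l2 {α : Type*} [MeasureSpace α] (f : α → ℝ≥0∞) : ℝ≥0∞ := (∫⁻ x, f x ^ 2) ^ (1 / 2 : ℝ)

theorem l2_sq {α : Type*} [MeasureSpace α] (f : α → ℝ≥0∞) : l2 f ^ 2 = ∫⁻ x, f x ^ 2 := by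
  rw [l2, ← ENNReal.rpow_natCast, ← ENNReal.rpow_mul]; norm_num

theorem rpow_half_le {x y : ℝ≥0∞} (h : x ≤ y ^ 2) : x ^ (1 / 2 : ℝ) ≤ y := by
  calc x ^ (1 / 2 : ℝ) ≤ (y ^ 2) ^ (1 / 2 : ℝ) := by gcongr
    _ = y := by rw [← ENNReal.rpow_natCast, ← ENNReal.rpow_mul]; norm_num

theorem lintegral_mul_le_l2 {α : Type*} [MeasureSpace α] {f g : α → ℝ≥0∞} (hf : Measurable f)
    (hg : Measurable g) : ∫⁻ x, f x * g x ≤ l2 f * l2 g := by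
  have := ENNReal.lintegral_mul_le_Lp_mul_Lq (volume : Measure α)
    (Real.HolderConjugate.two_two) hf.aemeasurable hg.aemeasurable
  simpa [l2] using this

/-- The trilinear form with kernel `K` on triples of frequencies summing to zero. -/
def triForm (K : SpaceTime → SpaceTime → SpaceTime → ℝ≥0∞) (F G H : SpaceTime → ℝ≥0∞) : ℝ≥0∞ :=
  ∫⁻ a, ∫⁻ b, K a b (-(a + b)) * (F a * G b * H (-(a + b)))

/-- Joint measurability of a kernel. -/
def KernelMeasurable (K : SpaceTime → SpaceTime → SpaceTime → ℝ≥0∞) : Prop :=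
  Measurable (fun x : SpaceTime × SpaceTime × SpaceTime => K x.1 x.2.1 x.2.2)

/-- `L² × L² × L²`-boundedness of the trilinear form of a kernel. -/
def L2Bounded (K : SpaceTime → SpaceTime → SpaceTime → ℝ≥0∞) : Prop :=
  ∃ C : ℝ≥0∞, C ≠ ∞ ∧ ∀ F G H : SpaceTime → ℝ≥0∞, Measurable F → Measurable G → Measurable H →
    triForm K F G H ≤ C * (l2 F * l2 G * l2 H)

theorem KernelMeasurable.comp {K : SpaceTime → SpaceTime → SpaceTime → ℝ≥0∞}
    (hK : KernelMeasurable K) {α : Type*} [MeasurableSpace α] {f g h : α → SpaceTime}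
    (hf : Measurable f) (hg : Measurable g) (hh : Measurable h) :
    Measurable (fun x => K (f x) (g x) (h x)) :=
  Measurable.comp (g := fun x : SpaceTime × SpaceTime × SpaceTime => K x.1 x.2.1 x.2.2) hK
    (hf.prodMk (hg.prodMk hh))

theorem triForm_swap {K : SpaceTime → SpaceTime → SpaceTime → ℝ≥0∞}
    (hK : KernelMeasurable K) {F G H : SpaceTime → ℝ≥0∞} (hF : Measurable F) (hG : Measurable G)
    (hH : Measurable H) :
    triForm (fun a b c => K b a c) F G H = triForm K G F H := by
  unfold triForm
  rw [lintegral_lintegral_swap]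
  · refine lintegral_congr fun a => lintegral_congr fun b => ?_
    rw [add_comm, mul_comm (F b)]
  · refine Measurable.aemeasurable ?_
    have := hK.comp (α := SpaceTime × SpaceTime) measurable_snd measurable_fst
      (h := fun p => -(p.1 + p.2)) (by fun_prop)
    exact this.mul (by fun_prop)

theorem triForm_rotate {K : SpaceTime → SpaceTime → SpaceTime → ℝ≥0∞}
    {F G H : SpaceTime → ℝ≥0∞} :
    triForm (fun a b c => K a c b) F G H = triForm K F H G := by
  unfold triForm
  refine lintegral_congr fun a => ?_
  rw [← lintegral_sub_left_eq_self _ (-a)]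
  refine lintegral_congr fun b => ?_
  have h1 : -(a + b) = -a - b := by abel
  have h2 : -(a + (-a - b)) = b := by abel
  rw [h2, h1, mul_right_comm]

theorem L2Bounded.swap {K : SpaceTime → SpaceTime → SpaceTime → ℝ≥0∞}
    (hK : KernelMeasurable K) (h : L2Bounded K) : L2Bounded (fun a b c => K b a c) := by
  obtain ⟨C, hC, h⟩ := h
  refine ⟨C, hC, fun F G H hF hG hH => ?_⟩
  rw [triForm_swap hK hF hG hH, mul_comm (l2 F)]
  exact h G F H hG hF hH

theorem L2Bounded.rotate {K : SpaceTime → SpaceTime → SpaceTime → ℝ≥0∞}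
    (h : L2Bounded K) : L2Bounded (fun a b c => K a c b) := by
  obtain ⟨C, hC, h⟩ := h
  refine ⟨C, hC, fun F G H hF hG hH => ?_⟩
  rw [triForm_rotate, mul_right_comm (l2 F)]
  exact h F H G hF hH hG

theorem KernelMeasurable.swap {K : SpaceTime → SpaceTime → SpaceTime → ℝ≥0∞}
    (hK : KernelMeasurable K) : KernelMeasurable (fun a b c => K b a c) :=
  hK.comp (by fun_prop) (by fun_prop) (by fun_prop)

theorem KernelMeasurable.rotate {K : SpaceTime → SpaceTime → SpaceTime → ℝ≥0∞}
    (hK : KernelMeasurable K) : KernelMeasurable (fun a b c => K a c b) :=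
  hK.comp (by fun_prop) (by fun_prop) (by fun_prop)

theorem L2Bounded.add {K K' : SpaceTime → SpaceTime → SpaceTime → ℝ≥0∞}
    (hK : KernelMeasurable K) (h : L2Bounded K) (h' : L2Bounded K') :
    L2Bounded (fun a b c => K a b c + K' a b c) := by
  obtain ⟨C, hC, h⟩ := h
  obtain ⟨C', hC', h'⟩ := h'
  refine ⟨C + C', by simp [hC, hC'], fun F G H hF hG hH => ?_⟩
  rw [add_mul]
  refine le_trans (le_of_eq ?_) (add_le_add (h F G H hF hG hH) (h' F G H hF hG hH))
  unfold triForm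
  have hm : Measurable (fun p : SpaceTime × SpaceTime =>
      K p.1 p.2 (-(p.1 + p.2)) * (F p.1 * G p.2 * H (-(p.1 + p.2)))) := by
    have := hK.comp (α := SpaceTime × SpaceTime) measurable_fst measurable_snd
      (h := fun p => -(p.1 + p.2)) (by fun_prop)
    exact this.mul (by fun_prop)
  rw [← lintegral_add_left hm.lintegral_prod_right']
  refine lintegral_congr fun a => ?_
  have hma : Measurable fun b => K a b (-(a + b)) * (F a * G b * H (-(a + b))) :=
    hm.comp (measurable_prodMk_left (x := a))
  rw [← lintegral_add_left hma]
  simp only [add_mul]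

theorem L2Bounded.mono {K K' : SpaceTime → SpaceTime → SpaceTime → ℝ≥0∞} (h : L2Bounded K')
    {C : ℝ≥0∞} (hC : C ≠ ∞) (hle : ∀ a b, K a b (-(a + b)) ≤ C * K' a b (-(a + b))) :
    L2Bounded K := by
  obtain ⟨C', hC', h⟩ := h
  refine ⟨C * C', ENNReal.mul_ne_top hC hC', fun F G H hF hG hH => ?_⟩
  rw [mul_assoc]
  refine le_trans ?_ (mul_le_mul_right (h F G H hF hG hH) C)
  unfold triForm
  rw [← lintegral_const_mul' _ _ hC]
  refine lintegral_mono fun a => ?_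
  rw [← lintegral_const_mul' _ _ hC]
  refine lintegral_mono fun b => ?_
  rw [← mul_assoc C]
  exact mul_le_mul' (hle a b) le_rfl

theorem triForm_le_of_fiber {K : SpaceTime → SpaceTime → SpaceTime → ℝ≥0∞}
    (hK : KernelMeasurable K) {A : ℝ≥0∞} (hA : ∀ a, ∫⁻ b, K a b (-(a + b)) ^ 2 ≤ A ^ 2)
    {F G H : SpaceTime → ℝ≥0∞} (hF : Measurable F) (hG : Measurable G) (hH : Measurable H) :
    triForm K F G H ≤ A * (l2 F * l2 G * l2 H) := by
  have hKm : ∀ a, Measurable fun b => K a b (-(a + b)) := fun a =>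
    hK.comp measurable_const measurable_id (by fun_prop)
  let P : SpaceTime → ℝ≥0∞ := fun a => l2 fun b => G b * H (-(a + b))
  have hP : Measurable P := by
    refine Measurable.pow_const ?_ _
    exact Measurable.lintegral_prod_right' (f := fun p : SpaceTime × SpaceTime =>
      (G p.2 * H (-(p.1 + p.2))) ^ 2) (by fun_prop)
  have hP2 : l2 P = l2 G * l2 H := by
    have : ∫⁻ a, P a ^ 2 = (∫⁻ b, G b ^ 2) * ∫⁻ b, H b ^ 2 := by
      simp only [P, l2_sq]
      rw [lintegral_lintegral_swap
        (by unfold Function.uncurry; fun_prop)]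
      rw [← lintegral_mul_const _ (by fun_prop)]
      refine lintegral_congr fun b => ?_
      simp only [mul_pow]
      rw [lintegral_const_mul _ (by fun_prop)]
      congr 1
      rw [← lintegral_sub_left_eq_self _ (-b)]
      refine lintegral_congr fun a => ?_
      congr 2; abel
    rw [l2, this, ENNReal.mul_rpow_of_nonneg _ _ (by norm_num)]; rfl
  calc triForm K F G H ≤ ∫⁻ a, F a * P a * A := by
        refine lintegral_mono fun a => ?_
        calc ∫⁻ b, K a b (-(a + b)) * (F a * G b * H (-(a + b)))
            = F a * ∫⁻ b, K a b (-(a + b)) * (G b * H (-(a + b))) := by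
              have hm : Measurable fun b => K a b (-(a + b)) * (G b * H (-(a + b))) :=
                (hKm a).mul (by fun_prop)
              rw [← lintegral_const_mul _ hm]
              refine lintegral_congr fun b => ?_
              ring
          _ ≤ F a * (A * P a) := by
              gcongr
              refine (lintegral_mul_le_l2 (hKm a) (by fun_prop)).trans ?_
              gcongr
              exact rpow_half_le (hA a)
          _ = F a * P a * A := by ring
    _ = (∫⁻ a, F a * P a) * A := lintegral_mul_const _ (by fun_prop)
    _ ≤ (l2 F * l2 P) * A := by gcongr; exact lintegral_mul_le_l2 hF hP
    _ = A * (l2 F * l2 G * l2 H) := by rw [hP2]; ring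

/-- Duality: a function whose pairings are controlled by the `L²` norm is in `L²`. -/
theorem l2_le_of_pairing {α : Type*} [MeasureSpace α] [SigmaFinite (volume : Measure α)]
    {f : α → ℝ≥0∞} (hf : Measurable f)
    {A : ℝ≥0∞} (h : ∀ g : α → ℝ≥0∞, Measurable g → ∫⁻ x, f x * g x ≤ A * l2 g) : l2 f ≤ A := by
  let S := spanningSets (volume : Measure α)
  let g : ℕ → α → ℝ≥0∞ := fun n => (S n).indicator fun x => min (f x) n
  have hg : ∀ n, Measurable (g n) := fun n =>
    (hf.min measurable_const).indicator (measurableSet_spanningSets _ n)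
  have hb : ∀ n, ∫⁻ x, g n x ^ 2 ≤ A ^ 2 := by
    intro n
    have hfin : ∫⁻ x, g n x ^ 2 ≠ ∞ := by
      refine ne_top_of_le_ne_top (b := ∫⁻ x, (S n).indicator (fun _ => (n : ℝ≥0∞) ^ 2) x) ?_ ?_
      · rw [lintegral_indicator_const (measurableSet_spanningSets _ n)]
        exact ENNReal.mul_ne_top (by simp) (measure_spanningSets_lt_top _ n).ne
      · refine lintegral_mono fun x => ?_
        by_cases hx : x ∈ S n
        · simp only [g, hx, Set.indicator_of_mem]
          gcongr; exact min_le_right _ _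
        · simp [g, hx]
    have h1 : l2 (g n) ^ 2 ≤ A * l2 (g n) := by
      rw [l2_sq]
      refine le_trans (lintegral_mono fun x => ?_) (h (g n) (hg n))
      rw [sq]
      gcongr
      by_cases hx : x ∈ S n
      · simp [g, hx]
      · simp [g, hx]
    rw [← l2_sq] at hfin ⊢
    have hfin' : l2 (g n) ≠ ∞ := fun hh => hfin (by simp [hh])
    gcongr
    by_cases h0 : l2 (g n) = 0
    · simp [h0]
    · rw [sq] at h1
      exact (ENNReal.mul_le_mul_iff_left h0 hfin').1 h1
  refine rpow_half_le ?_
  have hmono : Monotone fun n x => g n x ^ 2 := by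
    intro n m hnm x
    dsimp only [g]
    gcongr
    by_cases hx : x ∈ S n
    · have hx' : x ∈ S m := monotone_spanningSets _ hnm hx
      simp only [hx, hx', Set.indicator_of_mem]
      gcongr
    · simp [hx]
  have hsup : ∀ x, f x ^ 2 ≤ ⨆ n, g n x ^ 2 := by
    intro x
    obtain ⟨N, hN⟩ : ∃ N, x ∈ S N := by
      have : x ∈ ⋃ i, S i := by rw [iUnion_spanningSets]; trivial
      simpa using this
    have hx : ∀ n, N ≤ n → g n x = min (f x) n := fun n hn => by
      have : x ∈ S n := monotone_spanningSets _ hn hN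
      simp [g, this]
    have ht : Filter.Tendsto (fun n : ℕ => min (f x) n ^ 2) Filter.atTop (nhds (min (f x) ∞ ^ 2)) :=
      ((ENNReal.continuous_pow 2).tendsto _).comp
        (Filter.Tendsto.min tendsto_const_nhds ENNReal.tendsto_nat_nhds_top)
    rw [min_eq_left le_top] at ht
    refine le_of_tendsto ht ?_
    filter_upwards [Filter.eventually_ge_atTop N] with n hn
    rw [← hx n hn]
    exact le_iSup (fun n => g n x ^ 2) n
  calc ∫⁻ x, f x ^ 2 ≤ ∫⁻ x, ⨆ n, g n x ^ 2 := lintegral_mono hsup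
    _ = ⨆ n, ∫⁻ x, g n x ^ 2 := lintegral_iSup (fun n => (hg n).pow_const 2) hmono
    _ ≤ A ^ 2 := iSup_le hb

/-- The Euclidean length of a pair of reals. -/
def len (z : ℝ × ℝ) : ℝ := √(z.1 ^ 2 + z.2 ^ 2)

theorem len_nonneg (z : ℝ × ℝ) : 0 ≤ len z := Real.sqrt_nonneg _

theorem len_sq (z : ℝ × ℝ) : len z ^ 2 = z.1 ^ 2 + z.2 ^ 2 := Real.sq_sqrt (by positivity)

theorem measurable_len : Measurable len := by unfold len; fun_prop

/-- The derivative of the map `z ↦ (|z|, |z + v|)`. -/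
def bipolarDeriv (v z : ℝ × ℝ) : ℝ × ℝ →L[ℝ] ℝ × ℝ :=
  LinearMap.toContinuousLinearMap (Matrix.toLin (Module.Basis.finTwoProd ℝ)
    (Module.Basis.finTwoProd ℝ)
    !![z.1 / len z, z.2 / len z; (z.1 + v.1) / len (z + v), (z.2 + v.2) / len (z + v)])

theorem hasFDerivAt_len_add {v z : ℝ × ℝ} (h : len (z + v) ≠ 0) :
    HasFDerivAt (fun z => len (z + v))
      (((z.1 + v.1) / len (z + v)) • ContinuousLinearMap.fst ℝ ℝ ℝ +
        ((z.2 + v.2) / len (z + v)) • ContinuousLinearMap.snd ℝ ℝ ℝ) z := by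
  have h1 : HasFDerivAt (fun z : ℝ × ℝ => z.1 + v.1) (ContinuousLinearMap.fst ℝ ℝ ℝ) z :=
    hasFDerivAt_fst.add_const _
  have h2 : HasFDerivAt (fun z : ℝ × ℝ => z.2 + v.2) (ContinuousLinearMap.snd ℝ ℝ ℝ) z :=
    hasFDerivAt_snd.add_const _
  have h3 := ((h1.pow 2).add (h2.pow 2)).sqrt (by
    have := len_sq (z + v)
    simp only [Prod.fst_add, Prod.snd_add] at this
    have h0 : len (z + v) ^ 2 ≠ 0 := pow_ne_zero 2 h
    simpa [this] using h0)
  refine h3.congr_fderiv ?_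
  have hl : √((z.1 + v.1) ^ 2 + (z.2 + v.2) ^ 2) = len (z + v) := rfl
  ext <;> simp [hl] <;> field_simp

theorem hasFDerivAt_bipolar {v z : ℝ × ℝ} (h : len z ≠ 0) (h' : len (z + v) ≠ 0) :
    HasFDerivAt (fun z => (len z, len (z + v))) (bipolarDeriv v z) z := by
  have h1 := hasFDerivAt_len_add (v := 0) (z := z) (by simpa using h)
  simp only [add_zero, Prod.fst_zero, Prod.snd_zero] at h1
  rw [bipolarDeriv, Matrix.toLin_finTwoProd_toContinuousLinearMap]
  exact h1.prodMk (hasFDerivAt_len_add h')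

theorem abs_det_bipolarDeriv (v z : ℝ × ℝ) :
    |(bipolarDeriv v z).det| = |z.1 * v.2 - z.2 * v.1| * (len z * len (z + v))⁻¹ := by
  have : (bipolarDeriv v z).det = (z.1 * v.2 - z.2 * v.1) * (len z * len (z + v))⁻¹ := by
    rw [bipolarDeriv, LinearMap.det_toContinuousLinearMap, LinearMap.det_toLin,
      Matrix.det_fin_two_of]
    rw [mul_inv]; ring
  rw [this, abs_mul, abs_of_nonneg (a := (len z * len (z + v))⁻¹)]
  have := len_nonneg z
  have := len_nonneg (z + v)
  positivity

theorem len_pos_of_cross {v z : ℝ × ℝ} (h : z.1 * v.2 - z.2 * v.1 ≠ 0) :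
    0 < len z ∧ 0 < len (z + v) := by
  refine ⟨(len_nonneg z).lt_of_ne' fun h0 => h ?_, (len_nonneg _).lt_of_ne' fun h0 => h ?_⟩
  · have := len_sq z
    rw [h0] at this
    have h1 : z.1 = 0 := by nlinarith [sq_nonneg z.1, sq_nonneg z.2]
    have h2 : z.2 = 0 := by nlinarith [sq_nonneg z.1, sq_nonneg z.2]
    simp [h1, h2]
  · have := len_sq (z + v)
    rw [h0] at this
    simp only [Prod.fst_add, Prod.snd_add] at this
    have h1 : z.1 + v.1 = 0 := by nlinarith [sq_nonneg (z.1 + v.1), sq_nonneg (z.2 + v.2)]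
    have h2 : z.2 + v.2 = 0 := by nlinarith [sq_nonneg (z.1 + v.1), sq_nonneg (z.2 + v.2)]
    rw [eq_neg_of_add_eq_zero_left h1, eq_neg_of_add_eq_zero_left h2]; ring

theorem eq_of_len_eq {v z z' : ℝ × ℝ} (h1 : len z = len z') (h2 : len (z + v) = len (z' + v))
    (h : 0 < (z.1 * v.2 - z.2 * v.1) * (z'.1 * v.2 - z'.2 * v.1)) : z = z' := by
  have e1 := len_sq z
  have e2 := len_sq (z + v)
  rw [h1, len_sq] at e1
  rw [h2, len_sq] at e2
  simp only [Prod.fst_add, Prod.snd_add] at e2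
  have hdot : z.1 * v.1 + z.2 * v.2 = z'.1 * v.1 + z'.2 * v.2 := by linarith
  have hcr : (z.1 * v.2 - z.2 * v.1) ^ 2 = (z'.1 * v.2 - z'.2 * v.1) ^ 2 := by
    have a1 : (z.1 * v.2 - z.2 * v.1) ^ 2 =
      (z.1 ^ 2 + z.2 ^ 2) * (v.1 ^ 2 + v.2 ^ 2) - (z.1 * v.1 + z.2 * v.2) ^ 2 := by ring
    have a2 : (z'.1 * v.2 - z'.2 * v.1) ^ 2 =
      (z'.1 ^ 2 + z'.2 ^ 2) * (v.1 ^ 2 + v.2 ^ 2) - (z'.1 * v.1 + z'.2 * v.2) ^ 2 := by ring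
    rw [a1, a2, hdot, e1]
  have hcr' : z.1 * v.2 - z.2 * v.1 = z'.1 * v.2 - z'.2 * v.1 := by
    rcases sq_eq_sq_iff_eq_or_eq_neg.1 hcr with h' | h'
    · exact h'
    · rw [h'] at h
      nlinarith [sq_nonneg (z'.1 * v.2 - z'.2 * v.1)]
  have hv : v.1 ^ 2 + v.2 ^ 2 ≠ 0 := by
    intro h0
    have h1 : v.1 = 0 := by nlinarith [sq_nonneg v.1, sq_nonneg v.2]
    have h2 : v.2 = 0 := by nlinarith [sq_nonneg v.1, sq_nonneg v.2]
    simp [h1, h2] at h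
  ext
  · have : (z.1 - z'.1) * (v.1 ^ 2 + v.2 ^ 2) = 0 := by linear_combination v.1 * hdot + v.2 * hcr'
    simpa [hv, sub_eq_zero] using this
  · have : (z.2 - z'.2) * (v.1 ^ 2 + v.2 ^ 2) = 0 := by linear_combination v.2 * hdot - v.1 * hcr'
    simpa [hv, sub_eq_zero] using this

theorem lintegral_bipolar_half_le (v : ℝ × ℝ) (G : ℝ × ℝ → ℝ≥0∞) {s : Set (ℝ × ℝ)}
    (hs : MeasurableSet s) (hne : ∀ z ∈ s, z.1 * v.2 - z.2 * v.1 ≠ 0)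
    (hsame : ∀ z ∈ s, ∀ z' ∈ s, 0 < (z.1 * v.2 - z.2 * v.1) * (z'.1 * v.2 - z'.2 * v.1)) :
    ∫⁻ z in s, ENNReal.ofReal (|z.1 * v.2 - z.2 * v.1| * (len z * len (z + v))⁻¹) *
      G (len z, len (z + v)) ≤ ∫⁻ y in Set.Ioi 0 ×ˢ Set.Ioi 0, G y := by
  have key := lintegral_image_eq_lintegral_abs_det_fderiv_mul (volume : Measure (ℝ × ℝ)) hs
    (f := fun z => (len z, len (z + v))) (f' := bipolarDeriv v)
    (fun z hz => (hasFDerivAt_bipolar (len_pos_of_cross (hne z hz)).1.ne'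
      (len_pos_of_cross (hne z hz)).2.ne').hasFDerivWithinAt)
    (fun z hz z' hz' hzz' => eq_of_len_eq (congrArg Prod.fst hzz') (congrArg Prod.snd hzz')
      (hsame z hz z' hz')) G
  simp only [abs_det_bipolarDeriv] at key
  rw [← key]
  refine lintegral_mono_set ?_
  rintro _ ⟨z, hz, rfl⟩
  exact len_pos_of_cross (hne z hz)

theorem lintegral_bipolar_le (v : ℝ × ℝ) {G : ℝ × ℝ → ℝ≥0∞} (hG : Measurable G) :
    ∫⁻ z, ENNReal.ofReal (|z.1 * v.2 - z.2 * v.1| * (len z * len (z + v))⁻¹) *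
      G (len z, len (z + v)) ≤ 2 * ∫⁻ y in Set.Ioi 0 ×ˢ Set.Ioi 0, G y := by
  let J : ℝ × ℝ → ℝ := fun z => z.1 * v.2 - z.2 * v.1
  have hJ : Measurable J := by fun_prop
  have hp := lintegral_bipolar_half_le v G (s := {z | 0 < J z})
    (measurableSet_lt measurable_const hJ) (fun z hz => (show 0 < J z from hz).ne')
    (fun z hz z' hz' => mul_pos hz hz')
  have hn := lintegral_bipolar_half_le v G (s := {z | J z < 0})
    (measurableSet_lt hJ measurable_const) (fun z hz => (show J z < 0 from hz).ne)
    (fun z hz z' hz' => mul_pos_of_neg_of_neg hz hz')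
  have hl := measurable_len
  have hm : Measurable fun z : ℝ × ℝ =>
      ENNReal.ofReal (|z.1 * v.2 - z.2 * v.1| * (len z * len (z + v))⁻¹) *
        G (len z, len (z + v)) := by fun_prop
  rw [two_mul]
  refine le_trans ?_ (add_le_add hp hn)
  rw [← lintegral_indicator (measurableSet_lt measurable_const hJ),
    ← lintegral_indicator (measurableSet_lt hJ measurable_const),
    ← lintegral_add_left (hm.indicator (measurableSet_lt measurable_const hJ))]
  refine lintegral_mono fun z => ?_
  rcases lt_trichotomy (J z) 0 with h | h | h
  · rw [Set.indicator_of_mem (s := {z | J z < 0}) h]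
    exact le_add_self
  · have : z.1 * v.2 - z.2 * v.1 = 0 := h
    simp [this]
  · rw [Set.indicator_of_mem (s := {z | 0 < J z}) h]
    exact le_self_add

theorem lintegral_spaceTime {f : SpaceTime → ℝ≥0∞} (g : ℝ → ℝ × ℝ → ℝ≥0∞)
    (hg : Measurable (Function.uncurry g)) (h : ∀ ζ : SpaceTime, f ζ = g (ζ 0) (ζ 1, ζ 2)) :
    ∫⁻ ζ, f ζ = ∫⁻ t, ∫⁻ z, g t z := by
  have e1 := PiLp.volume_preserving_ofLp (Fin 3)
  have e2 := volume_preserving_piFinSuccAbove (fun _ : Fin 3 => ℝ) 0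
  have e3 := (MeasurePreserving.id (volume : Measure ℝ)).prod
    (volume_preserving_finTwoArrow ℝ)
  have e := e3.comp (e2.comp e1)
  rw [← Measure.volume_eq_prod] at e
  have hp := lintegral_prod (μ := (volume : Measure ℝ)) (ν := (volume : Measure (ℝ × ℝ))) _
    hg.aemeasurable
  rw [← Measure.volume_eq_prod, ← e.lintegral_comp hg] at hp
  rw [lintegral_congr h]
  exact hp

/-- The weight `1 + ||τ| - |ξ||` measuring the distance to the light cone. -/
def coneWeight (ζ : SpaceTime) : ℝ := 1 + |(|ζ 0| - spFreq ζ)|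

/-- The absolute value of the planar cross product of the spatial parts. -/
def cross (a b : SpaceTime) : ℝ := |a 1 * b 2 - a 2 * b 1|

theorem one_le_coneWeight (ζ : SpaceTime) : 1 ≤ coneWeight ζ :=
  le_add_of_nonneg_right (abs_nonneg _)

theorem coneWeight_pos (ζ : SpaceTime) : 0 < coneWeight ζ :=
  zero_lt_one.trans_le (one_le_coneWeight ζ)

theorem spFreq_nonneg (ζ : SpaceTime) : 0 ≤ spFreq ζ := Real.sqrt_nonneg _

theorem cross_nonneg (a b : SpaceTime) : 0 ≤ cross a b := abs_nonneg _

theorem measurable_spFreq : Measurable spFreq := by unfold spFreq; fun_prop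

theorem measurable_coneWeight : Measurable coneWeight := by
  have := measurable_spFreq
  unfold coneWeight
  fun_prop

theorem measurable_cross : Measurable fun x : SpaceTime × SpaceTime => cross x.1 x.2 := by
  unfold cross; fun_prop

theorem spFreq_neg (ζ : SpaceTime) : spFreq (-ζ) = spFreq ζ := by simp [spFreq]

theorem coneWeight_neg (ζ : SpaceTime) : coneWeight (-ζ) = coneWeight ζ := by
  simp [coneWeight, spFreq_neg]

/-- The total mass of `(1 + |x|) ^ (-p)` on the line. -/
def bracketMass (p : ℝ) : ℝ≥0∞ := ∫⁻ x : ℝ, ENNReal.ofReal ((1 + |x|) ^ (-p))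

theorem bracketMass_ne_top {p : ℝ} (hp : 1 < p) : bracketMass p ≠ ∞ :=
  (finite_integral_one_add_norm (E := ℝ) (μ := volume) (by simpa using hp)).ne

theorem lintegral_bracket_sub_left (p c : ℝ) :
    ∫⁻ x : ℝ, ENNReal.ofReal ((1 + |c - x|) ^ (-p)) = bracketMass p :=
  lintegral_sub_left_eq_self (fun x => ENNReal.ofReal ((1 + |x|) ^ (-p))) c

theorem lintegral_bracket_abs_sub_le (p c : ℝ) :
    ∫⁻ x : ℝ, ENNReal.ofReal ((1 + |(|x| - c)|) ^ (-p)) ≤ 2 * bracketMass p := by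
  have h1 : ∫⁻ x : ℝ, ENNReal.ofReal ((1 + |x - c|) ^ (-p)) = bracketMass p :=
    lintegral_sub_right_eq_self (fun x => ENNReal.ofReal ((1 + |x|) ^ (-p))) c
  have h2 : ∫⁻ x : ℝ, ENNReal.ofReal ((1 + |-c - x|) ^ (-p)) = bracketMass p :=
    lintegral_bracket_sub_left p (-c)
  rw [two_mul]
  nth_rw 1 [← h1]
  rw [← h2, ← lintegral_add_left (by fun_prop)]
  refine lintegral_mono fun x => ?_
  rcases le_total 0 x with hx | hx
  · rw [abs_of_nonneg hx]; exact le_self_add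
  · rw [abs_of_nonpos hx, show -x - c = -c - x by ring]; exact le_add_self

theorem lintegral_cross_le {p : ℝ} {g : ℝ → ℝ≥0∞} (hg : Measurable g) (a : SpaceTime) :
    ∫⁻ b, ENNReal.ofReal (cross a b * (spFreq b * spFreq (-(a + b)))⁻¹) *
      (g (spFreq b) * ENNReal.ofReal (coneWeight b ^ (-p)) *
        ENNReal.ofReal (coneWeight (-(a + b)) ^ (-p))) ≤
    4 * bracketMass p ^ 2 * ∫⁻ ρ in Set.Ioi 0, g ρ := by
  have hl := measurable_len
  let v : ℝ × ℝ := (a 1, a 2)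
  let w : ℝ → ℝ → ℝ≥0∞ := fun t ρ => ENNReal.ofReal ((1 + |(|t| - ρ)|) ^ (-p))
  have hw : Measurable (Function.uncurry w) := by
    simp only [w, Function.uncurry_def]; fun_prop
  let G : ℝ → ℝ × ℝ → ℝ≥0∞ := fun t y => g y.1 * w t y.1 * w (a 0 + t) y.2
  have hG : Measurable (Function.uncurry G) := by
    simp only [G, w, Function.uncurry_def]; fun_prop
  rw [lintegral_spaceTime (fun t z => ENNReal.ofReal
    (|z.1 * v.2 - z.2 * v.1| * (len z * len (z + v))⁻¹) * G t (len z, len (z + v)))]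
  · have h1 : ∀ t, ∫⁻ z, ENNReal.ofReal
        (|z.1 * v.2 - z.2 * v.1| * (len z * len (z + v))⁻¹) * G t (len z, len (z + v)) ≤
        2 * bracketMass p * ∫⁻ ρ in Set.Ioi 0, g ρ * w t ρ := by
      intro t
      have hGt : Measurable (G t) := hG.of_uncurry_left
      have hgw : Measurable fun ρ => g ρ * w t ρ := hg.mul hw.of_uncurry_left
      refine (lintegral_bipolar_le v hGt).trans ?_
      rw [mul_assoc]
      gcongr
      rw [Measure.volume_eq_prod, ← Measure.prod_restrict, lintegral_prod _ hGt.aemeasurable,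
        ← lintegral_const_mul _ hgw]
      refine lintegral_mono fun ρ => ?_
      simp only [G]
      rw [lintegral_const_mul _ hw.of_uncurry_left, mul_comm]
      gcongr
      exact (setLIntegral_le_lintegral _ _).trans (lintegral_bracket_sub_left p _).le
    refine (lintegral_mono h1).trans ?_
    rw [lintegral_const_mul, lintegral_lintegral_swap]
    · rw [show (4 : ℝ≥0∞) * bracketMass p ^ 2 = (2 * bracketMass p) * (2 * bracketMass p) by ring,
        mul_assoc (2 * bracketMass p)]
      gcongr
      rw [← lintegral_const_mul _ hg]
      refine lintegral_mono fun ρ => ?_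
      simp only
      rw [lintegral_const_mul _ hw.of_uncurry_right, mul_comm]
      gcongr
      exact lintegral_bracket_abs_sub_le p ρ
    · exact ((hg.comp measurable_snd).mul hw).aemeasurable
    · exact Measurable.lintegral_prod_right' (f := fun x : ℝ × ℝ => g x.2 * w x.1 x.2)
        ((hg.comp measurable_snd).mul hw)
  · simp only [Function.uncurry_def]
    refine Measurable.mul (by fun_prop) ?_
    exact hG.comp (by fun_prop : Measurable fun x : ℝ × ℝ × ℝ => (x.1, len x.2, len (x.2 + v)))
  · intro ζ
    have e1 : spFreq ζ = len (ζ 1, ζ 2) := rfl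
    have e2 : spFreq (-(a + ζ)) = len ((ζ 1, ζ 2) + v) := by
      rw [spFreq_neg]; simp [spFreq, len, v, add_comm]
    have e3 : cross a ζ = |ζ 1 * v.2 - ζ 2 * v.1| := by
      rw [cross, abs_sub_comm]; simp only [v]; congr 1; ring
    have e4 : coneWeight (-(a + ζ)) = 1 + |(|a 0 + ζ 0| - len ((ζ 1, ζ 2) + v))| := by
      rw [coneWeight, e2]; congr 3; rw [PiLp.neg_apply, abs_neg, PiLp.add_apply]
    rw [e1, e2, e3, e4]
    rfl

theorem lintegral_bracket_mul_coneWeight_le {p q : ℝ} (a : SpaceTime) :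
    ∫⁻ b, ENNReal.ofReal ((1 + spFreq b) ^ (-q)) * ENNReal.ofReal (coneWeight (-(a + b)) ^ (-p)) ≤
    2 * bracketMass p * ∫⁻ z : ℝ × ℝ, ENNReal.ofReal ((1 + len z) ^ (-q)) := by
  have hl := measurable_len
  let v : ℝ × ℝ := (a 1, a 2)
  rw [lintegral_spaceTime (fun t z => ENNReal.ofReal ((1 + len z) ^ (-q)) *
    ENNReal.ofReal ((1 + |(|a 0 + t| - len (z + v))|) ^ (-p)))]
  · rw [lintegral_lintegral_swap (by fun_prop), ← lintegral_const_mul _ (by fun_prop)]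
    refine lintegral_mono fun z => ?_
    simp only
    rw [lintegral_const_mul _ (by fun_prop), mul_comm]
    gcongr
    rw [lintegral_add_left_eq_self
      (fun t => ENNReal.ofReal ((1 + |(|t| - len (z + v))|) ^ (-p))) (a 0)]
    exact lintegral_bracket_abs_sub_le p _
  · simp only [Function.uncurry_def]; fun_prop
  · intro ζ
    have e2 : spFreq (-(a + ζ)) = len ((ζ 1, ζ 2) + v) := by
      rw [spFreq_neg]; simp [spFreq, len, v, add_comm]
    have e4 : coneWeight (-(a + ζ)) = 1 + |(|a 0 + ζ 0| - len ((ζ 1, ζ 2) + v))| := by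
      rw [coneWeight, e2]; congr 3; rw [PiLp.neg_apply, abs_neg, PiLp.add_apply]
    rw [e4]
    rfl

theorem norm_le_len (z : ℝ × ℝ) : ‖z‖ ≤ len z := by
  rw [Prod.norm_def, Real.norm_eq_abs, Real.norm_eq_abs]
  exact max_le (Real.abs_le_sqrt (by nlinarith [sq_nonneg z.2]))
    (Real.abs_le_sqrt (by nlinarith [sq_nonneg z.1]))

theorem lintegral_bracket_len_ne_top {q : ℝ} (hq : 2 < q) :
    ∫⁻ z : ℝ × ℝ, ENNReal.ofReal ((1 + len z) ^ (-q)) ≠ ∞ := by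
  refine ne_top_of_le_ne_top (finite_integral_one_add_norm (E := ℝ × ℝ) (μ := volume) (r := q)
    (by simpa using hq)).ne (lintegral_mono fun z => ENNReal.ofReal_le_ofReal ?_)
  exact Real.rpow_le_rpow_of_nonpos (by positivity) (by linarith [norm_le_len z]) (by linarith)

theorem ofReal_sqrt_sq (x : ℝ) : ENNReal.ofReal √x ^ 2 = ENNReal.ofReal x := by
  rcases le_total 0 x with h | h
  · rw [← ENNReal.ofReal_pow (Real.sqrt_nonneg x), Real.sq_sqrt h]
  · simp [Real.sqrt_eq_zero_of_nonpos h, ENNReal.ofReal_of_nonpos h]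

theorem rpow_half_sq (x : ℝ≥0∞) : (x ^ (1 / 2 : ℝ)) ^ 2 = x := by
  rw [← ENNReal.rpow_natCast, ← ENNReal.rpow_mul]; norm_num

/-- The square of the kernel gaining integrability in the size of the second frequency. -/
def sizeKernelSq (g : ℝ → ℝ) (p : ℝ) (a b c : SpaceTime) : ℝ :=
  cross a b * (spFreq b * spFreq c)⁻¹ *
    (g (spFreq b) * coneWeight b ^ (-p) * coneWeight c ^ (-p))

/-- The square of the kernel handled by integrating over all second frequencies. -/
def volumeKernelSq (q p : ℝ) (_ b c : SpaceTime) : ℝ :=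
  (1 + spFreq b) ^ (-q) * coneWeight c ^ (-p)

/-- The square of the kernel gaining in the size of the first frequency. -/
def orthoKernelSq (q p : ℝ) (a b c : SpaceTime) : ℝ :=
  cross a b * (spFreq b * spFreq c)⁻¹ *
    ((1 + spFreq a) ^ (-q) * coneWeight b ^ (-p) * coneWeight c ^ (-p))

/-- The `ℝ≥0∞`-valued square root of a real kernel. -/
def rootKernel (Q : SpaceTime → SpaceTime → SpaceTime → ℝ) (a b c : SpaceTime) : ℝ≥0∞ :=
  ENNReal.ofReal √(Q a b c)

theorem kernelMeasurable_sizeKernelSq {g : ℝ → ℝ} (hg : Measurable g) (p : ℝ) :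
    KernelMeasurable (rootKernel (sizeKernelSq g p)) := by
  have h1 := measurable_spFreq
  have h2 := measurable_coneWeight
  have h3 : Measurable fun x : SpaceTime × SpaceTime × SpaceTime => cross x.1 x.2.1 :=
    measurable_cross.comp (by fun_prop : Measurable fun x : SpaceTime × SpaceTime × SpaceTime =>
      (x.1, x.2.1))
  unfold KernelMeasurable rootKernel sizeKernelSq
  fun_prop

theorem kernelMeasurable_volumeKernelSq (q p : ℝ) :
    KernelMeasurable (rootKernel (volumeKernelSq q p)) := by
  have h1 := measurable_spFreq
  have h2 := measurable_coneWeight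
  unfold KernelMeasurable rootKernel volumeKernelSq
  fun_prop

theorem kernelMeasurable_orthoKernelSq (q p : ℝ) :
    KernelMeasurable (rootKernel (orthoKernelSq q p)) := by
  have h1 := measurable_spFreq
  have h2 := measurable_coneWeight
  have h3 : Measurable fun x : SpaceTime × SpaceTime × SpaceTime => cross x.1 x.2.1 :=
    measurable_cross.comp (by fun_prop : Measurable fun x : SpaceTime × SpaceTime × SpaceTime =>
      (x.1, x.2.1))
  unfold KernelMeasurable rootKernel orthoKernelSq
  fun_prop

theorem L2Bounded.of_fiber {K : SpaceTime → SpaceTime → SpaceTime → ℝ≥0∞}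
    (hK : KernelMeasurable K) {B : ℝ≥0∞} (hB : B ≠ ∞) (h : ∀ a, ∫⁻ b, K a b (-(a + b)) ^ 2 ≤ B) :
    L2Bounded K :=
  ⟨B ^ (1 / 2 : ℝ), ENNReal.rpow_ne_top_of_nonneg (by norm_num) hB, fun _ _ _ hF hG hH =>
    triForm_le_of_fiber hK (fun a => (h a).trans (rpow_half_sq B).ge) hF hG hH⟩

theorem lintegral_sizeKernelSq_le {g : ℝ → ℝ} (hg : Measurable g) (hg0 : ∀ ρ, 0 ≤ g ρ) (p : ℝ)
    (a : SpaceTime) :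
    ∫⁻ b, rootKernel (sizeKernelSq g p) a b (-(a + b)) ^ 2 ≤
      4 * bracketMass p ^ 2 * ∫⁻ ρ in Set.Ioi 0, ENNReal.ofReal (g ρ) := by
  refine le_trans (lintegral_mono fun b => ?_) (lintegral_cross_le hg.ennreal_ofReal a)
  have h1 := cross_nonneg a b
  have h2 := spFreq_nonneg b
  have h3 := spFreq_nonneg (-(a + b))
  have h4 := hg0 (spFreq b)
  have h5 := coneWeight_pos b
  rw [rootKernel, ofReal_sqrt_sq, sizeKernelSq,
    ENNReal.ofReal_mul (p := cross a b * _) (by positivity),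
    ENNReal.ofReal_mul (p := g (spFreq b) * _) (by positivity), ENNReal.ofReal_mul h4]

theorem l2Bounded_sizeKernelSq {g : ℝ → ℝ} (hg : Measurable g) (hg0 : ∀ ρ, 0 ≤ g ρ) {p : ℝ}
    (hp : 1 < p) (hgi : ∫⁻ ρ in Set.Ioi 0, ENNReal.ofReal (g ρ) ≠ ∞) :
    L2Bounded (rootKernel (sizeKernelSq g p)) :=
  .of_fiber (kernelMeasurable_sizeKernelSq hg p)
    (ENNReal.mul_ne_top (ENNReal.mul_ne_top (by norm_num)
      (ENNReal.pow_ne_top (bracketMass_ne_top hp))) hgi) (lintegral_sizeKernelSq_le hg hg0 p)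

theorem l2Bounded_volumeKernelSq {q p : ℝ} (hq : 2 < q) (hp : 1 < p) :
    L2Bounded (rootKernel (volumeKernelSq q p)) := by
  refine .of_fiber (kernelMeasurable_volumeKernelSq q p)
    (ENNReal.mul_ne_top (ENNReal.mul_ne_top (by norm_num) (bracketMass_ne_top hp))
      (lintegral_bracket_len_ne_top hq)) fun a =>
    le_trans (lintegral_mono fun b => ?_) (lintegral_bracket_mul_coneWeight_le a)
  have h2 := spFreq_nonneg b
  rw [rootKernel, ofReal_sqrt_sq, volumeKernelSq, ENNReal.ofReal_mul (by positivity)]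

theorem lintegral_singular_bracket_ne_top {η : ℝ} (hη : 1 / 2 < η) :
    ∫⁻ ρ in Set.Ioi (0 : ℝ), ENNReal.ofReal (ρ ^ (-(1 / 2) : ℝ) * (1 + ρ) ^ (-η)) ≠ ∞ := by
  have hsplit : Set.Ioi (0 : ℝ) = Set.Ioc 0 1 ∪ Set.Ioi 1 :=
    (Set.Ioc_union_Ioi_eq_Ioi zero_le_one).symm
  rw [hsplit]
  refine ne_top_of_le_ne_top ?_ (lintegral_union_le _ _ _)
  refine ENNReal.add_ne_top.2 ⟨?_, ?_⟩
  · have hi : IntegrableOn (fun ρ : ℝ => ρ ^ (-(1 / 2) : ℝ)) (Set.Ioc 0 1) :=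
      (intervalIntegrable_iff_integrableOn_Ioc_of_le zero_le_one).1
        (intervalIntegral.intervalIntegrable_rpow' (by norm_num))
    refine ne_top_of_le_ne_top hi.2.ne (setLIntegral_mono' measurableSet_Ioc fun ρ hρ => ?_)
    rw [Real.enorm_eq_ofReal (Real.rpow_nonneg hρ.1.le _)]
    refine ENNReal.ofReal_le_ofReal (mul_le_of_le_one_right (Real.rpow_nonneg hρ.1.le _) ?_)
    exact Real.rpow_le_one_of_one_le_of_nonpos (by linarith [hρ.1]) (by linarith)
  · have hi : IntegrableOn (fun ρ : ℝ => ρ ^ (-(1 / 2) - η : ℝ)) (Set.Ioi 1) :=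
      integrableOn_Ioi_rpow_of_lt (by linarith) zero_lt_one
    refine ne_top_of_le_ne_top hi.2.ne (setLIntegral_mono' measurableSet_Ioi fun ρ hρ => ?_)
    have h0 : (0 : ℝ) < ρ := zero_lt_one.trans hρ
    rw [Real.enorm_eq_ofReal (Real.rpow_nonneg h0.le _), sub_eq_add_neg, Real.rpow_add h0]
    refine ENNReal.ofReal_le_ofReal (mul_le_mul_of_nonneg_left ?_ (Real.rpow_nonneg h0.le _))
    exact Real.rpow_le_rpow_of_nonpos h0 (by linarith) (by linarith)

/-- The `ℝ≥0∞`-valued indicator of `|x - c| < L`. -/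
def window (L x c : ℝ) : ℝ≥0∞ := if |x - c| < L then 1 else 0

theorem measurable_window (L : ℝ) : Measurable fun x : ℝ × ℝ => window L x.1 x.2 :=
  Measurable.ite (measurableSet_lt (by fun_prop) measurable_const) measurable_const
    measurable_const

theorem window_sq (L x c : ℝ) : window L x c ^ 2 = window L x c := by
  unfold window; split_ifs <;> simp

theorem window_comm (L x c : ℝ) : window L x c = window L c x := by
  unfold window; rw [abs_sub_comm]

theorem lintegral_window (L x : ℝ) : ∫⁻ c, window L x c = ENNReal.ofReal (2 * L) := by
  have : ∀ c, window L x c = (Metric.ball x L).indicator 1 c := by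
    intro c
    simp only [window, Set.indicator, Metric.mem_ball, Real.dist_eq, Pi.one_apply, abs_sub_comm]
  simp_rw [this]
  rw [lintegral_indicator_one measurableSet_ball, Real.volume_ball]

/-- The restriction of a function to frequencies in a window around `c`. -/
def localized (L : ℝ) (f : SpaceTime → ℝ≥0∞) (c : ℝ) (x : SpaceTime) : ℝ≥0∞ :=
  window L (spFreq x) c * f x

theorem l2_localized {L : ℝ} {f : SpaceTime → ℝ≥0∞} (hf : Measurable f) :
    l2 (fun c : ℝ => l2 (localized L f c)) =
      ENNReal.ofReal (2 * L) ^ (1 / 2 : ℝ) * l2 f := by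
  have hw : Measurable fun x : ℝ × SpaceTime => window L (spFreq x.2) x.1 :=
    (measurable_window L).comp ((measurable_spFreq.comp measurable_snd).prodMk measurable_fst)
  rw [l2]
  simp_rw [l2_sq, localized, mul_pow, window_sq]
  rw [lintegral_lintegral_swap (by
    exact (hw.mul ((hf.comp measurable_snd).pow_const 2)).aemeasurable)]
  have : ∀ x, ∫⁻ c, window L (spFreq x) c * f x ^ 2 = ENNReal.ofReal (2 * L) * f x ^ 2 := by
    intro x
    rw [lintegral_mul_const _ ((measurable_window L).of_uncurry_left (x := spFreq x)),
      lintegral_window]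
  simp_rw [this]
  rw [lintegral_const_mul _ (by fun_prop), ENNReal.mul_rpow_of_nonneg _ _ (by norm_num), l2]

theorem const_mul_lintegral_le_of_average {α β γ : Type*} [MeasureSpace α] [MeasureSpace β]
    [MeasureSpace γ] [SFinite (volume : Measure α)] [SFinite (volume : Measure β)]
    [SFinite (volume : Measure γ)] {T : γ → α → β → ℝ≥0∞}
    (hT : Measurable fun x : (α × β) × γ => T x.2 x.1.1 x.1.2) {S : α → β → ℝ≥0∞} {k : ℝ}
    (h : ∀ a b, ENNReal.ofReal k * S a b ≤ ∫⁻ c, T c a b) :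
    ENNReal.ofReal k * ∫⁻ a, ∫⁻ b, S a b ≤ ∫⁻ c, ∫⁻ a, ∫⁻ b, T c a b := by
  have hm1 : ∀ a, Measurable fun x : γ × β => T x.1 a x.2 := fun a =>
    hT.comp (by fun_prop : Measurable fun x : γ × β => ((a, x.2), x.1))
  have hm2 : Measurable fun x : γ × α => ∫⁻ b, T x.1 x.2 b :=
    Measurable.lintegral_prod_right' (f := fun y : (γ × α) × β => T y.1.1 y.1.2 y.2)
      (hT.comp (by fun_prop : Measurable fun y : (γ × α) × β => ((y.1.2, y.2), y.1.1)))
  rw [lintegral_lintegral_swap (f := fun c a => ∫⁻ b, T c a b) hm2.aemeasurable,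
    ← lintegral_const_mul' _ _ ENNReal.ofReal_ne_top]
  refine lintegral_mono fun a => ?_
  simp only
  rw [lintegral_lintegral_swap (f := fun c b => T c a b) (hm1 a).aemeasurable,
    ← lintegral_const_mul' _ _ ENNReal.ofReal_ne_top]
  exact lintegral_mono fun b => h a b

theorem triForm_le_of_windowed_fiber {K : SpaceTime → SpaceTime → SpaceTime → ℝ≥0∞}
    (hK : KernelMeasurable K) {L : ℝ} (hL : 0 < L) {A : ℝ≥0∞}
    (hsupp : ∀ a b, K a b (-(a + b)) ≠ 0 → |spFreq b - spFreq (-(a + b))| ≤ L)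
    (hA : ∀ (c : ℝ) (a), ∫⁻ b, (window L (spFreq b) c * K a b (-(a + b))) ^ 2 ≤ A ^ 2)
    {F G H : SpaceTime → ℝ≥0∞} (hF : Measurable F) (hG : Measurable G) (hH : Measurable H) :
    triForm K F G H ≤ 2 * A * (l2 F * l2 G * l2 H) := by
  have hr := measurable_spFreq
  have hw : ∀ (M : ℝ) {α : Type} [MeasurableSpace α] {f g : α → ℝ}, Measurable f →
      Measurable g → Measurable fun x => window M (f x) (g x) :=
    fun M _ _ _ _ hf hg => (measurable_window M).comp (hf.prodMk hg)
  have hloc : ∀ {f : SpaceTime → ℝ≥0∞}, Measurable f →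
      ∀ {α : Type} [MeasurableSpace α] {c : α → ℝ} {x : α → SpaceTime}, Measurable c →
      Measurable x → Measurable fun y => localized (2 * L) f (c y) (x y) :=
    fun hf _ _ _ _ hc hx => (hw _ (hr.comp hx) hc).mul (hf.comp hx)
  let Kc : ℝ → SpaceTime → SpaceTime → SpaceTime → ℝ≥0∞ :=
    fun c a b d => window L (spFreq b) c * K a b d
  have hpt : ∀ a b, ENNReal.ofReal (2 * L) * (K a b (-(a + b)) *
      (F a * G b * H (-(a + b)))) ≤
      ∫⁻ c, Kc c a b (-(a + b)) * (F a * localized (2 * L) G c b * localized (2 * L) H c (-(a + b))) := by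
    intro a b
    rw [← lintegral_window L (spFreq b), ← lintegral_mul_const _ (hw _ (by fun_prop) (by fun_prop))]
    refine lintegral_mono fun c => ?_
    by_cases h0 : K a b (-(a + b)) = 0
    · rw [h0, zero_mul, mul_zero]
      exact zero_le
    by_cases hc : |spFreq b - c| < L
    · have hd := hsupp a b h0
      have h1 : window L (spFreq b) c = 1 := if_pos hc
      have h2 : window (2 * L) (spFreq b) c = 1 := if_pos (by linarith)
      have h3 : window (2 * L) (spFreq (-(a + b))) c = 1 := by
        refine if_pos ?_
        rw [abs_lt] at hc ⊢
        rw [abs_le] at hd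
        constructor <;> linarith [hd.1, hd.2, hc.1, hc.2]
      simp only [Kc, localized, h1, h2, h3, one_mul, le_refl]
    · have h1 : window L (spFreq b) c = 0 := if_neg hc
      simp [h1]
  have hmeas : Measurable fun x : (SpaceTime × SpaceTime) × ℝ =>
      Kc x.2 x.1.1 x.1.2 (-(x.1.1 + x.1.2)) *
        (F x.1.1 * localized (2 * L) G x.2 x.1.2 * localized (2 * L) H x.2 (-(x.1.1 + x.1.2))) := by
    refine ((hw _ (by fun_prop) (by fun_prop)).mul
      (hK.comp (by fun_prop) (by fun_prop) (by fun_prop))).mul ?_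
    exact ((hF.comp (by fun_prop)).mul (hloc hG (by fun_prop) (by fun_prop))).mul
      (hloc hH (by fun_prop) (by fun_prop))
  have hswap := const_mul_lintegral_le_of_average hmeas hpt
  have hbound : ∫⁻ c, triForm (Kc c) F (localized (2 * L) G c) (localized (2 * L) H c) ≤
      ENNReal.ofReal (2 * L) * (2 * A * (l2 F * l2 G * l2 H)) := by
    have hl2 : ∀ {f : SpaceTime → ℝ≥0∞}, Measurable f → Measurable fun c => l2 (localized (2 * L) f c) :=
      fun hf => (Measurable.lintegral_prod_right' ((hloc hf measurable_fst measurable_snd).pow_const 2)).pow_const _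
    calc ∫⁻ c, triForm (Kc c) F (localized (2 * L) G c) (localized (2 * L) H c)
        ≤ ∫⁻ c, A * l2 F * (l2 (localized (2 * L) G c) * l2 (localized (2 * L) H c)) := by
          refine lintegral_mono fun c => ?_
          refine (triForm_le_of_fiber (G := localized (2 * L) G c) (H := localized (2 * L) H c)
            ?_ (hA c) hF (hloc hG measurable_const measurable_id)
            (hloc hH measurable_const measurable_id)).trans (le_of_eq (by ring))
          exact (hw _ (by fun_prop) (by fun_prop)).mul hK
      _ = A * l2 F * ∫⁻ c, l2 (localized (2 * L) G c) * l2 (localized (2 * L) H c) :=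
          lintegral_const_mul _ ((hl2 hG).mul (hl2 hH))
      _ ≤ A * l2 F * (ENNReal.ofReal (2 * (2 * L)) ^ (1 / 2 : ℝ) * l2 G *
            (ENNReal.ofReal (2 * (2 * L)) ^ (1 / 2 : ℝ) * l2 H)) := by
          gcongr
          refine (lintegral_mul_le_l2 (hl2 hG) (hl2 hH)).trans (le_of_eq ?_)
          rw [l2_localized hG, l2_localized hH]
      _ = (ENNReal.ofReal (2 * (2 * L)) ^ (1 / 2 : ℝ)) ^ 2 * (A * (l2 F * l2 G * l2 H)) := by ring
      _ = _ := by
          rw [rpow_half_sq, ENNReal.ofReal_mul zero_le_two]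
          simp only [ENNReal.ofReal_ofNat]
          ring
  exact (ENNReal.mul_le_mul_iff_right (by simpa using hL) ENNReal.ofReal_ne_top).1
    (hswap.trans hbound)

theorem spFreq_sq (a : SpaceTime) : spFreq a ^ 2 = a 1 ^ 2 + a 2 ^ 2 := Real.sq_sqrt (by positivity)

theorem spFreq_add_le (a b : SpaceTime) : spFreq (a + b) ≤ spFreq a + spFreq b := by
  have ha := spFreq_nonneg a
  have hb := spFreq_nonneg b
  refine Real.sqrt_le_iff.2 ⟨by positivity, ?_⟩
  have h : a 1 * b 1 + a 2 * b 2 ≤ spFreq a * spFreq b := by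
    refine abs_le_of_sq_le_sq' ?_ (by positivity) |>.2
    rw [mul_pow, spFreq_sq, spFreq_sq]
    nlinarith [sq_nonneg (a 1 * b 2 - a 2 * b 1)]
  rw [add_sq, spFreq_sq, spFreq_sq]
  simp only [PiLp.add_apply]
  nlinarith

theorem abs_spFreq_sub_le (a b : SpaceTime) : |spFreq b - spFreq (-(a + b))| ≤ spFreq a := by
  rw [spFreq_neg, abs_le]
  have h1 := spFreq_add_le a b
  have h2 := spFreq_add_le (a + b) (-a)
  rw [spFreq_neg, add_neg_cancel_comm] at h2
  constructor <;> linarith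

/-- The indicator of the dyadic shell `2 ^ n ≤ 1 + |ξ| < 2 ^ (n + 1)`. -/
def dyadicShell (n : ℕ) (a : SpaceTime) : ℝ≥0∞ :=
  if 2 ^ n ≤ 1 + spFreq a ∧ 1 + spFreq a < 2 ^ (n + 1) then 1 else 0

theorem measurable_dyadicShell (n : ℕ) : Measurable (dyadicShell n) := by
  have := measurable_spFreq
  have h1 : MeasurableSet {a : SpaceTime | 2 ^ n ≤ 1 + spFreq a} :=
    measurableSet_le measurable_const (by fun_prop)
  have h2 : MeasurableSet {a : SpaceTime | 1 + spFreq a < 2 ^ (n + 1)} :=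
    measurableSet_lt (by fun_prop) measurable_const
  exact Measurable.ite (h1.inter h2) measurable_const measurable_const

theorem one_le_tsum_dyadicShell (a : SpaceTime) : 1 ≤ ∑' n, dyadicShell n a := by
  obtain ⟨n, h1, h2⟩ := exists_nat_pow_near (x := 1 + spFreq a) (y := 2)
    (le_add_of_nonneg_right (spFreq_nonneg a)) one_lt_two
  refine le_trans (le_of_eq ?_) (ENNReal.le_tsum n)
  exact (if_pos ⟨h1, h2⟩).symm

theorem lintegral_window_orthoKernelSq_le {q p : ℝ} (hq : 0 ≤ q) (n : ℕ) (c : ℝ) (a : SpaceTime) :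
    ∫⁻ b, (window (2 ^ (n + 1)) (spFreq b) c *
      (dyadicShell n a * rootKernel (orthoKernelSq q p) a b (-(a + b)))) ^ 2 ≤
      (4 * bracketMass p * ENNReal.ofReal (2 ^ ((1 - q) / 2)) ^ n) ^ 2 := by
  by_cases hS : 2 ^ n ≤ 1 + spFreq a ∧ 1 + spFreq a < 2 ^ (n + 1)
  swap
  · simp [dyadicShell, if_neg hS]
  have hg : Measurable fun ρ => (window (2 ^ (n + 1)) ρ c).toReal :=
    (measurable_window _).of_uncurry_right.ennreal_toReal
  have hw : ∀ ρ, ENNReal.ofReal (window (2 ^ (n + 1)) ρ c).toReal = window (2 ^ (n + 1)) ρ c := by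
    intro ρ
    refine ENNReal.ofReal_toReal ?_
    unfold window
    split_ifs <;> simp
  have hpt : ∀ b, (window (2 ^ (n + 1)) (spFreq b) c *
      (dyadicShell n a * rootKernel (orthoKernelSq q p) a b (-(a + b)))) ^ 2 ≤
      ENNReal.ofReal ((2 ^ n) ^ (-q)) * rootKernel (sizeKernelSq
        (fun ρ => (window (2 ^ (n + 1)) ρ c).toReal) p) a b (-(a + b)) ^ 2 := by
    intro b
    rw [dyadicShell, if_pos hS, one_mul, mul_pow, window_sq, rootKernel, rootKernel,
      ofReal_sqrt_sq, ofReal_sqrt_sq, ← hw, ← ENNReal.ofReal_mul ENNReal.toReal_nonneg,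
      ← ENNReal.ofReal_mul (by positivity)]
    refine ENNReal.ofReal_le_ofReal ?_
    have h1 := cross_nonneg a b
    have h2 := spFreq_nonneg b
    have h3 := spFreq_nonneg (-(a + b))
    have h5 := coneWeight_pos b
    have h6 := coneWeight_pos (-(a + b))
    have h7 : (1 + spFreq a) ^ (-q) ≤ (2 ^ n) ^ (-q) :=
      Real.rpow_le_rpow_of_nonpos (by positivity) hS.1 (by linarith)
    have h8 : 0 ≤ (window (2 ^ (n + 1)) (spFreq b) c).toReal := ENNReal.toReal_nonneg
    calc (window (2 ^ (n + 1)) (spFreq b) c).toReal * orthoKernelSq q p a b (-(a + b))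
        = (1 + spFreq a) ^ (-q) * sizeKernelSq
          (fun ρ => (window (2 ^ (n + 1)) ρ c).toReal) p a b (-(a + b)) := by
          simp only [orthoKernelSq, sizeKernelSq]; ring
      _ ≤ _ := by
          refine mul_le_mul_of_nonneg_right h7 ?_
          simp only [sizeKernelSq]
          positivity
  refine (lintegral_mono hpt).trans ?_
  rw [lintegral_const_mul' _ _ ENNReal.ofReal_ne_top]
  calc _ ≤ ENNReal.ofReal ((2 ^ n) ^ (-q)) *
        (4 * bracketMass p ^ 2 * ENNReal.ofReal (2 * 2 ^ (n + 1))) := by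
        gcongr
        refine (lintegral_sizeKernelSq_le hg (fun _ => ENNReal.toReal_nonneg) p a).trans ?_
        gcongr
        refine (setLIntegral_le_lintegral _ _).trans (le_of_eq ?_)
        simp_rw [hw, window_comm]
        exact lintegral_window _ _
    _ = 4 * bracketMass p ^ 2 * ENNReal.ofReal ((2 ^ n) ^ (-q) * (2 * 2 ^ (n + 1))) := by
        rw [ENNReal.ofReal_mul (p := (2 ^ n) ^ (-q)) (by positivity)]; ring
    _ = 4 * bracketMass p ^ 2 * ENNReal.ofReal (4 * ((2 ^ ((1 - q) / 2)) ^ n) ^ 2) := by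
        congr 2
        rw [← Real.rpow_natCast 2 n, ← Real.rpow_natCast (2 ^ ((1 - q) / 2)) n, pow_succ,
          ← Real.rpow_natCast 2 n, ← Real.rpow_natCast _ 2, ← Real.rpow_mul zero_le_two,
          ← Real.rpow_mul zero_le_two, ← Real.rpow_mul zero_le_two,
          show (1 - q) / 2 * n * ((2 : ℕ) : ℝ) = n * -q + n by push_cast; ring,
          Real.rpow_add zero_lt_two]
        ring
    _ = _ := by
        rw [ENNReal.ofReal_mul (by norm_num), ENNReal.ofReal_pow (by positivity),
          ENNReal.ofReal_pow (by positivity)]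
        simp only [ENNReal.ofReal_ofNat]
        ring

theorem triForm_le_tsum {K : SpaceTime → SpaceTime → SpaceTime → ℝ≥0∞}
    (hK : KernelMeasurable K) {χ : ℕ → SpaceTime → ℝ≥0∞} (hχ : ∀ n, Measurable (χ n))
    (h1 : ∀ a, 1 ≤ ∑' n, χ n a) {F G H : SpaceTime → ℝ≥0∞}
    (hF : Measurable F) (hG : Measurable G) (hH : Measurable H) :
    triForm K F G H ≤ ∑' n, triForm (fun a b c => χ n a * K a b c) F G H := by
  have hm : ∀ n, Measurable fun x : SpaceTime × SpaceTime =>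
      χ n x.1 * K x.1 x.2 (-(x.1 + x.2)) * (F x.1 * G x.2 * H (-(x.1 + x.2))) := fun n =>
    (((hχ n).comp (by fun_prop)).mul (hK.comp (by fun_prop) (by fun_prop) (by fun_prop))).mul
      (by fun_prop)
  unfold triForm
  rw [← lintegral_tsum fun n => (Measurable.lintegral_prod_right' (hm n)).aemeasurable]
  refine lintegral_mono fun a => ?_
  simp only
  have hma : ∀ n, Measurable fun b =>
      χ n a * K a b (-(a + b)) * (F a * G b * H (-(a + b))) := fun n =>
    (hm n).comp measurable_prodMk_left
  rw [← lintegral_tsum fun n => (hma n).aemeasurable]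
  refine lintegral_mono fun b => ?_
  simp only [ENNReal.tsum_mul_right]
  gcongr
  exact le_mul_of_one_le_left' (h1 a)

theorem l2Bounded_orthoKernelSq {q p : ℝ} (hq : 1 < q) (hp : 1 < p) :
    L2Bounded (rootKernel (orthoKernelSq q p)) := by
  have hK := kernelMeasurable_orthoKernelSq q p
  let R := ENNReal.ofReal (2 ^ ((1 - q) / 2))
  have hR : R < 1 := by
    rw [← ENNReal.ofReal_one]
    exact (ENNReal.ofReal_lt_ofReal_iff zero_lt_one).2
      (Real.rpow_lt_one_of_one_lt_of_neg one_lt_two (by linarith))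
  refine ⟨∑' n, 2 * (4 * bracketMass p * R ^ n), ?_, fun F G H hF hG hH => ?_⟩
  · rw [ENNReal.tsum_mul_left, ENNReal.tsum_mul_left, ENNReal.tsum_geometric]
    refine ENNReal.mul_ne_top (by norm_num) (ENNReal.mul_ne_top
      (ENNReal.mul_ne_top (by norm_num) (bracketMass_ne_top hp)) ?_)
    exact ENNReal.inv_ne_top.2 (tsub_pos_of_lt hR).ne'
  · refine (triForm_le_tsum hK measurable_dyadicShell one_le_tsum_dyadicShell hF hG hH).trans ?_
    rw [← ENNReal.tsum_mul_right]
    refine ENNReal.tsum_le_tsum fun n => ?_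
    refine triForm_le_of_windowed_fiber (L := 2 ^ (n + 1)) ?_ (by positivity) (fun a b h => ?_)
      (lintegral_window_orthoKernelSq_le (by linarith) n) hF hG hH
    · exact ((measurable_dyadicShell n).comp measurable_fst).mul hK
    · refine (abs_spFreq_sub_le a b).trans ?_
      by_contra hlt
      refine h ?_
      rw [dyadicShell, if_neg, zero_mul]
      rintro ⟨-, h2⟩
      linarith

/-- The exponents of the null form estimate together with the auxiliary decay exponents. -/
structure Exponents where
  (s s' β θ₀ θ₁ p η qO qV : ℝ)
  hs : 1 / 2 < s
  hs1 : s ≤ 1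
  hs' : 1 / 4 < s'
  hs'_le : s' ≤ 1
  hβ : 1 / 4 ≤ β
  hp : 1 < p
  hpθ₀ : p ≤ 2 * θ₀
  hpθ₁ : p ≤ 2 * θ₁
  hθ₁ : θ₁ < 3 / 4
  hpβ : 2 * β ≤ p
  hpβ₀ : p - 2 * β ≤ 2 * θ₀ - 1 / 2
  hpβ₁ : p - 2 * β ≤ 2 * θ₁ - 1 / 2
  hη : 1 / 2 < η
  hηs : η ≤ 2 * s'
  hηp : η ≤ 2 * s' + 2 * θ₁ - 1 / 2 - p
  hqO : 1 < qO
  hqO1 : qO ≤ 1 / 2 + 2 * s'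
  hqO2 : qO ≤ 3 / 2 + 4 * s' - 2 * s
  hqV : 2 < qV
  hqV1 : qV ≤ 3 + 4 * s' - 2 * s
  hqV2 : qV ≤ 2 * s' + 2 * θ₁

namespace Exponents

variable (e : Exponents)

/-- The logarithm of the squared kernel, up to a bounded error, in terms of the logarithms `R2`
of the last frequency, `B` of the brackets, `ω` of the cone weights and `Ω` of the cross product. -/
def logKernel (R2 B0 B1 B2 ω0 ω1 ω2 Ω : ℝ) : ℝ :=
  (2 * e.s - 2) * B0 - 2 * e.s * B1 - 2 * R2 - 2 * e.s' * B2 + 2 * Ω -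
    2 * e.β * ω0 - 2 * e.θ₀ * ω1 - 2 * e.θ₁ * ω2

/-- The logarithm of the size kernel. -/
def logSize (Ω Rb Bb Rc ωb ωc : ℝ) : ℝ :=
  Ω - 3 / 2 * Rb - e.η * Bb - Rc - e.p * (ωb + ωc)

/-- The logarithm of the ortho kernel. -/
def logOrtho (Ω Ba Rb Rc ωb ωc : ℝ) : ℝ :=
  Ω - e.qO * Ba - Rb - Rc - e.p * (ωb + ωc)

theorem logKernel_le_of_low_output {R0 R1 R2 B0 B1 B2 ω0 ω1 ω2 Ω : ℝ}
    (hB0 : 0 ≤ B0) (hR0 : R0 ≤ B0) (hR1 : R1 ≤ B1)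
    (hω0 : 0 ≤ ω0) (hω1 : 0 ≤ ω1) (hω2 : 0 ≤ ω2)
    (h01 : B0 ≤ B1) (h02 : B0 ≤ B2) (hR12 : R1 ≤ R2 + 1)
    (hk : 2 * Ω ≤ 3 + R0 + R1 + R2 + ω0 ∧ ω1 ≤ ω0 ∧ ω2 ≤ ω0 ∨
      2 * Ω ≤ 3 + R0 + R1 + R2 + ω1 ∧ ω0 ≤ ω1 ∧ ω2 ≤ ω1 ∨
      2 * Ω ≤ 3 + R0 + R1 + R2 + ω2 ∧ ω0 ≤ ω2 ∧ ω1 ≤ ω2) :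
    e.logKernel R2 B0 B1 B2 ω0 ω1 ω2 Ω ≤ 18 + e.logSize Ω R0 B0 R2 ω0 ω2 ∨
    e.logKernel R2 B0 B1 B2 ω0 ω1 ω2 Ω ≤ 18 + e.logSize Ω R0 B0 R1 ω0 ω1 ∨
    e.logKernel R2 B0 B1 B2 ω0 ω1 ω2 Ω ≤ 18 + e.logOrtho Ω B0 R1 R2 ω1 ω2 := by
  obtain ⟨s, s', β, θ₀, θ₁, p, η, qO, qV, hs, hs1, hs', hs'_le, hβ, hp, hpθ₀, hpθ₁, hθ₁, hpβ, hpβ₀,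
    hpβ₁, hη, hηs, hηp, hqO, hqO1, hqO2, hqV, hqV1, hqV2⟩ := e
  simp only [logKernel, logSize, logOrtho]
  have f1 : 0 ≤ (2 * s - 1) * (B1 - B0) := mul_nonneg (by linarith) (by linarith)
  have f1' : 0 ≤ s * (B1 - B0) := mul_nonneg (by linarith) (by linarith)
  have f2 : 0 ≤ s' * (B2 - B0) := mul_nonneg (by linarith) (by linarith)
  have f3 : 0 ≤ (2 * s' - η) * B0 := mul_nonneg (by linarith) hB0
  have f4 : 0 ≤ (1 / 2 + 2 * s' - qO) * B0 := mul_nonneg (by linarith) hB0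
  have g0 : 0 ≤ (β - 1 / 4) * ω0 := mul_nonneg (by linarith) hω0
  have g1 : 0 ≤ (2 * θ₀ - p) * ω1 := mul_nonneg (by linarith) hω1
  have g2 : 0 ≤ (2 * θ₁ - p) * ω2 := mul_nonneg (by linarith) hω2
  rcases hk with ⟨h, h1, h2⟩ | ⟨h, h1, h2⟩ | ⟨h, h1, h2⟩
  · right; right
    linarith
  · left
    have g3 : 0 ≤ (p - 2 * β) * (ω1 - ω0) := mul_nonneg (by linarith) (by linarith)
    have g4 : 0 ≤ (2 * θ₀ - 1 / 2 - (p - 2 * β)) * ω1 := mul_nonneg (by linarith) hω1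
    linarith
  · right; left
    have g3 : 0 ≤ (p - 2 * β) * (ω2 - ω0) := mul_nonneg (by linarith) (by linarith)
    have g4 : 0 ≤ (2 * θ₁ - 1 / 2 - (p - 2 * β)) * ω2 := mul_nonneg (by linarith) hω2
    linarith

theorem logKernel_le_of_low_first {R0 R1 R2 B0 B1 B2 ω0 ω1 ω2 Ω : ℝ}
    (hB1 : 0 ≤ B1) (hR1 : R1 ≤ B1) (hR2 : R2 ≤ B2)
    (hω0 : 0 ≤ ω0) (hω1 : 0 ≤ ω1) (hω2 : 0 ≤ ω2)
    (h10 : B1 ≤ B0) (h12 : B1 ≤ B2)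
    (hR02 : R0 ≤ R2 + 1) (hB20 : B2 ≤ B0 + 1)
    (hk : 2 * Ω ≤ 3 + R0 + R1 + R2 + ω0 ∧ ω1 ≤ ω0 ∧ ω2 ≤ ω0 ∨
      2 * Ω ≤ 3 + R0 + R1 + R2 + ω1 ∧ ω0 ≤ ω1 ∧ ω2 ≤ ω1 ∨
      2 * Ω ≤ 3 + R0 + R1 + R2 + ω2 ∧ ω0 ≤ ω2 ∧ ω1 ≤ ω2) :
    e.logKernel R2 B0 B1 B2 ω0 ω1 ω2 Ω ≤ 18 + e.logSize Ω R1 B1 R2 ω1 ω2 ∨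
    e.logKernel R2 B0 B1 B2 ω0 ω1 ω2 Ω ≤ 18 + e.logSize Ω R1 B1 R0 ω1 ω0 ∨
    e.logKernel R2 B0 B1 B2 ω0 ω1 ω2 Ω ≤ 18 + e.logOrtho Ω B1 R0 R2 ω0 ω2 ∨
    e.logKernel R2 B0 B1 B2 ω0 ω1 ω2 Ω ≤ 18 + (-e.qV * B1 - e.p * ω2) := by
  obtain ⟨s, s', β, θ₀, θ₁, p, η, qO, qV, hs, hs1, hs', hs'_le, hβ, hp, hpθ₀, hpθ₁, hθ₁, hpβ, hpβ₀,
    hpβ₁, hη, hηs, hηp, hqO, hqO1, hqO2, hqV, hqV1, hqV2⟩ := e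
  simp only [logKernel, logSize, logOrtho]
  have f1 : 0 ≤ (2 - 2 * s) * (B0 - B1) := mul_nonneg (by linarith) (by linarith)
  have f2 : 0 ≤ s' * (B2 - B1) := mul_nonneg (by linarith) (by linarith)
  have f3 : 0 ≤ (2 * s' - η) * B1 := mul_nonneg (by linarith) hB1
  have f4 : 0 ≤ (1 / 2 + 2 * s' - qO) * B1 := mul_nonneg (by linarith) hB1
  have f5 : 0 ≤ (2 - 2 * s) * (B0 + 1 - B2) := mul_nonneg (by linarith) (by linarith)
  have g0 : 0 ≤ (β - 1 / 4) * ω0 := mul_nonneg (by linarith) hω0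
  have g1 : 0 ≤ (2 * θ₀ - p) * ω1 := mul_nonneg (by linarith) hω1
  have g2 : 0 ≤ (2 * θ₁ - p) * ω2 := mul_nonneg (by linarith) hω2
  rcases hk with ⟨h, h1, h2⟩ | ⟨h, h1, h2⟩ | ⟨h, h1, h2⟩
  · left
    linarith
  · have g3 : 0 ≤ (p - 2 * β) * (ω1 - ω0) := mul_nonneg (by linarith) (by linarith)
    have g4 : 0 ≤ (2 * θ₀ - 1 / 2 - (p - 2 * β)) * ω1 := mul_nonneg (by linarith) hω1
    right; right
    rcases le_total B2 (2 * B1) with hle | hge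
    · left
      rcases le_total (2 * s - 1 - 2 * s') 0 with hn | hn
      · have f6 : 0 ≤ -(2 * s - 1 - 2 * s') * (B2 - B1) := mul_nonneg (by linarith) (by linarith)
        linarith
      · have f6 : 0 ≤ (2 * s - 1 - 2 * s') * (2 * B1 - B2) := mul_nonneg hn (by linarith)
        have f7 : 0 ≤ (3 / 2 + 4 * s' - 2 * s - qO) * B1 := mul_nonneg (by linarith) hB1
        linarith
    · right
      have f6 : 0 ≤ (2 + 2 * s' - 2 * s) * (B2 - 2 * B1) := mul_nonneg (by linarith) (by linarith)
      have f7 : 0 ≤ (3 + 4 * s' - 2 * s - qV) * B1 := mul_nonneg (by linarith) hB1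
      have g5 : 0 ≤ (2 * θ₀ - 1) * ω1 := mul_nonneg (by linarith) hω1
      linarith
  · right; left
    have g3 : 0 ≤ (p - 2 * β) * (ω2 - ω0) := mul_nonneg (by linarith) (by linarith)
    have g4 : 0 ≤ (2 * θ₁ - 1 / 2 - (p - 2 * β)) * ω2 := mul_nonneg (by linarith) hω2
    linarith

theorem logKernel_le_of_low_second {R0 R1 R2 B0 B1 B2 ω0 ω1 ω2 Ω : ℝ}
    (hB2 : 0 ≤ B2) (hR0 : R0 ≤ B0)
    (hω0 : 0 ≤ ω0) (hω1 : 0 ≤ ω1) (hω2 : 0 ≤ ω2) (hΩ : Ω ≤ R0 + R2)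
    (hR10 : R1 ≤ R0 + 1) (hB01 : B0 ≤ B1 + 1)
    (hk : 2 * Ω ≤ 3 + R0 + R1 + R2 + ω0 ∧ ω1 ≤ ω0 ∧ ω2 ≤ ω0 ∨
      2 * Ω ≤ 3 + R0 + R1 + R2 + ω1 ∧ ω0 ≤ ω1 ∧ ω2 ≤ ω1 ∨
      2 * Ω ≤ 3 + R0 + R1 + R2 + ω2 ∧ ω0 ≤ ω2 ∧ ω1 ≤ ω2) :
    e.logKernel R2 B0 B1 B2 ω0 ω1 ω2 Ω ≤ 18 + e.logSize Ω R2 B2 R1 ω2 ω1 ∨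
    e.logKernel R2 B0 B1 B2 ω0 ω1 ω2 Ω ≤ 18 + e.logSize Ω R2 B2 R0 ω2 ω0 ∨
    e.logKernel R2 B0 B1 B2 ω0 ω1 ω2 Ω ≤ 18 + (-e.qV * B2 - e.p * ω1) := by
  obtain ⟨s, s', β, θ₀, θ₁, p, η, qO, qV, hs, hs1, hs', hs'_le, hβ, hp, hpθ₀, hpθ₁, hθ₁, hpβ, hpβ₀,
    hpβ₁, hη, hηs, hηp, hqO, hqO1, hqO2, hqV, hqV1, hqV2⟩ := e
  simp only [logKernel, logSize]
  have f1 : 0 ≤ 2 * s * (B1 + 1 - B0) := mul_nonneg (by linarith) (by linarith)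
  have f3 : 0 ≤ (2 * s' - η) * B2 := mul_nonneg (by linarith) hB2
  have g0 : 0 ≤ (β - 1 / 4) * ω0 := mul_nonneg (by linarith) hω0
  have g1 : 0 ≤ (2 * θ₀ - p) * ω1 := mul_nonneg (by linarith) hω1
  have g2 : 0 ≤ (2 * θ₁ - p) * ω2 := mul_nonneg (by linarith) hω2
  rcases hk with ⟨h, h1, h2⟩ | ⟨h, h1, h2⟩ | ⟨h, h1, h2⟩
  · left
    linarith
  · right; left
    have g3 : 0 ≤ (p - 2 * β) * (ω1 - ω0) := mul_nonneg (by linarith) (by linarith)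
    have g4 : 0 ≤ (2 * θ₀ - 1 / 2 - (p - 2 * β)) * ω1 := mul_nonneg (by linarith) hω1
    linarith
  · rcases le_total ω2 B2 with hle | hge
    · left
      have g3 : 0 ≤ (p - (2 * θ₁ - 1 / 2)) * (B2 - ω2) := mul_nonneg (by linarith) (by linarith)
      have f4 : 0 ≤ (2 * s' + 2 * θ₁ - 1 / 2 - p - η) * B2 := mul_nonneg (by linarith) hB2
      linarith
    · right; right
      have g3 : 0 ≤ 2 * θ₁ * (ω2 - B2) := mul_nonneg (by linarith) (by linarith)
      have f4 : 0 ≤ (2 * s' + 2 * θ₁ - qV) * B2 := mul_nonneg (by linarith) hB2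
      linarith

end Exponents

theorem heron_le {x y z w : ℝ} (hx : 0 ≤ x) (hy : 0 ≤ y) (hz : 0 ≤ z) (hxz : y ≤ x + z)
    (hxy : z ≤ x + y) (hw : y + z - x ≤ 3 * w) (hyz : x ≤ y + z) :
    (x + y + z) * (y + z - x) * (x + z - y) * (x + y - z) ≤ 48 * (x * y * z) * w := by
  have h1 : (x + y + z) * (x + z - y) * (x + y - z) ≤ 16 * (x * y * z) := by
    have hs : x + y + z ≤ 2 * (y + z) := by linarith
    have hm : ∀ {u v : ℝ}, 0 ≤ u → u ≤ v → x ≤ u + v → 0 ≤ x + v - u → 0 ≤ x + u - v →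
        x + u + v ≤ 2 * (u + v) →
        (x + u + v) * (x + v - u) * (x + u - v) ≤ 16 * (x * u * v) := by
      intro u v hu huv h1 h2 h3 h4
      have hv : 0 ≤ v := hu.trans huv
      calc (x + u + v) * (x + v - u) * (x + u - v) ≤ (4 * v) * (2 * x) * (2 * u) := by
            gcongr <;> linarith
        _ ≤ 16 * (x * u * v) := by linarith
    rcases le_total y z with h | h
    · exact hm hy h hyz (by linarith) (by linarith) hs
    · have := hm hz h (by linarith) (by linarith) (by linarith) (by linarith)
      linarith
  calc (x + y + z) * (y + z - x) * (x + z - y) * (x + y - z)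
      = ((x + y + z) * (x + z - y) * (x + y - z)) * (y + z - x) := by ring
    _ ≤ (16 * (x * y * z)) * (3 * w) := by
        gcongr
    _ = _ := by ring

theorem cross_comm (a b : SpaceTime) : cross a b = cross b a := by
  rw [cross, cross, abs_sub_comm]; congr 1; ring

theorem cross_neg_add (a b : SpaceTime) : cross a (-(a + b)) = cross a b := by
  rw [cross, cross, ← abs_neg]
  congr 1
  simp only [PiLp.neg_apply, PiLp.add_apply]
  ring

theorem cross_le (a b : SpaceTime) : cross a b ≤ spFreq a * spFreq b := by
  have ha := spFreq_nonneg a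
  have hb := spFreq_nonneg b
  refine abs_le_of_sq_le_sq ?_ (by positivity)
  rw [mul_pow, spFreq_sq, spFreq_sq]
  nlinarith [sq_nonneg (a 1 * b 1 + a 2 * b 2)]

theorem four_mul_cross_sq (a b : SpaceTime) :
    4 * cross a b ^ 2 = (spFreq (-(a + b)) + spFreq a + spFreq b) *
      (spFreq a + spFreq b - spFreq (-(a + b))) * (spFreq (-(a + b)) + spFreq b - spFreq a) *
      (spFreq (-(a + b)) + spFreq a - spFreq b) := by
  have h1 := spFreq_sq a
  have h2 := spFreq_sq b
  have h3 := spFreq_sq (-(a + b))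
  simp only [PiLp.neg_apply, PiLp.add_apply] at h3
  rw [cross, sq_abs]
  have key : 4 * (a 1 * b 2 - a 2 * b 1) ^ 2 =
      4 * spFreq a ^ 2 * spFreq b ^ 2 -
        (spFreq (-(a + b)) ^ 2 - spFreq a ^ 2 - spFreq b ^ 2) ^ 2 := by
    rw [h1, h2, h3]; ring
  rw [key]; ring

theorem cross_sq_le (a b : SpaceTime) {w : ℝ} (ha : coneWeight a ≤ w) (hb : coneWeight b ≤ w)
    (hc : coneWeight (-(a + b)) ≤ w) :
    cross a b ^ 2 ≤ 12 * (spFreq a * spFreq b * spFreq (-(a + b))) * w := by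
  have hw1 := (one_le_coneWeight a).trans ha
  have h0 := four_mul_cross_sq a b
  have ra := spFreq_nonneg a
  have rb := spFreq_nonneg b
  have rc := spFreq_nonneg (-(a + b))
  have t1 : spFreq (-(a + b)) ≤ spFreq a + spFreq b := by
    rw [spFreq_neg]; exact spFreq_add_le a b
  have t2 := abs_le.1 (abs_spFreq_sub_le a b)
  have t3 : spFreq (-(a + b)) ≥ spFreq a - spFreq b := by
    have := spFreq_add_le (a + b) (-b)
    rw [spFreq_neg, add_neg_cancel_right] at this
    rw [spFreq_neg]; linarith
  simp only [coneWeight] at ha hb hc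
  have ha' := abs_le.1 (by linarith : |(|a 0| - spFreq a)| ≤ w)
  have hb' := abs_le.1 (by linarith : |(|b 0| - spFreq b)| ≤ w)
  have hc' := abs_le.1 (by linarith : |(|(-(a + b)) 0| - spFreq (-(a + b)))| ≤ w)
  have habs : |(-(a + b)) 0| = |a 0 + b 0| := by rw [PiLp.neg_apply, abs_neg, PiLp.add_apply]
  rw [habs] at hc'
  have hcases : |a 0 + b 0| = |a 0| + |b 0| ∨ |a 0| = |a 0 + b 0| + |b 0| ∨
      |b 0| = |a 0 + b 0| + |a 0| := by
    rcases abs_cases (a 0) with h | h <;> rcases abs_cases (b 0) with h' | h' <;>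
      rcases abs_cases (a 0 + b 0) with h'' | h'' <;>
      first
      | (left; linarith)
      | (right; left; linarith)
      | (right; right; linarith)
  generalize spFreq (-(a + b)) = x at *
  generalize spFreq a = y at *
  generalize spFreq b = z at *
  rcases hcases with h | h | h
  · have := heron_le (w := w) rc ra rb (by linarith) (by linarith) (by linarith) (by linarith)
    linarith
  · have := heron_le (w := w) ra rc rb (by linarith) (by linarith) (by linarith) (by linarith)
    linarith
  · have := heron_le (w := w) rb rc ra (by linarith) (by linarith) (by linarith) (by linarith)
    linarith

namespace Exponents

variable (e : Exponents)

/-- The squared kernel of the null form as a function of sizes. -/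
def kernelValue (W r₀ r₁ r₂ w₀ w₁ w₂ : ℝ) : ℝ :=
  (1 + r₀ ^ 2) ^ (e.s - 1) * (1 + r₁ ^ 2) ^ (-e.s) * (1 + r₂ ^ 2) ^ (-e.s') * (r₂ ^ 2)⁻¹ * W ^ 2 *
    (w₀ ^ (-(2 * e.β)) * w₁ ^ (-(2 * e.θ₀)) * w₂ ^ (-(2 * e.θ₁)))

/-- The density in the size variable used for the low frequency interactions. -/
def density (ρ : ℝ) : ℝ := ρ ^ (-(1 / 2) : ℝ) * (1 + ρ) ^ (-e.η)

/-- The squared size kernel as a function of sizes. -/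
def sizeValue (W rb rc wb wc : ℝ) : ℝ :=
  W * (rb * rc)⁻¹ * (e.density rb * wb ^ (-e.p) * wc ^ (-e.p))

/-- The squared ortho kernel as a function of sizes. -/
def orthoValue (W ra rb rc wb wc : ℝ) : ℝ :=
  W * (rb * rc)⁻¹ * ((1 + ra) ^ (-e.qO) * wb ^ (-e.p) * wc ^ (-e.p))

/-- The squared volume kernel as a function of sizes. -/
def volumeValue (rb wc : ℝ) : ℝ := (1 + rb) ^ (-e.qV) * wc ^ (-e.p)

theorem sizeValue_eq_exp {W rb rc wb wc : ℝ} (hW : 0 < W) (hb : 0 < rb) (hc : 0 < rc)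
    (hwb : 0 < wb) (hwc : 0 < wc) :
    e.sizeValue W rb rc wb wc = exp (e.logSize (log W) (log rb) (log (1 + rb)) (log rc)
      (log wb) (log wc)) := by
  rw [sizeValue, density, logSize, Real.rpow_def_of_pos hb, Real.rpow_def_of_pos hwb,
    Real.rpow_def_of_pos hwc, Real.rpow_def_of_pos (by linarith : 0 < 1 + rb)]
  nth_rw 1 [← Real.exp_log hW, ← Real.exp_log hb, ← Real.exp_log hc]
  simp only [← Real.exp_add, ← Real.exp_neg]
  congr 1; ring

theorem orthoValue_eq_exp {W ra rb rc wb wc : ℝ} (hW : 0 < W) (ha : 0 < ra) (hb : 0 < rb)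
    (hc : 0 < rc) (hwb : 0 < wb) (hwc : 0 < wc) :
    e.orthoValue W ra rb rc wb wc = exp (e.logOrtho (log W) (log (1 + ra)) (log rb) (log rc)
      (log wb) (log wc)) := by
  rw [orthoValue, logOrtho, Real.rpow_def_of_pos hwb,
    Real.rpow_def_of_pos hwc, Real.rpow_def_of_pos (by linarith : 0 < 1 + ra)]
  nth_rw 1 [← Real.exp_log hW, ← Real.exp_log hb, ← Real.exp_log hc]
  simp only [← Real.exp_add, ← Real.exp_neg]
  congr 1; ring

theorem volumeValue_eq_exp {rb wc : ℝ} (hb : 0 < rb) (hwc : 0 < wc) :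
    e.volumeValue rb wc = exp (-e.qV * log (1 + rb) - e.p * log wc) := by
  rw [volumeValue, Real.rpow_def_of_pos hwc, Real.rpow_def_of_pos (by linarith : 0 < 1 + rb),
    ← Real.exp_add]
  congr 1; ring

theorem two_mul_log_one_add_le {r : ℝ} (hr : 0 < r) :
    2 * log (1 + r) ≤ log (1 + r ^ 2) + 1 ∧ log (1 + r ^ 2) ≤ 2 * log (1 + r) := by
  have h1 : 2 * log (1 + r) = log ((1 + r) ^ 2) := by rw [Real.log_pow]; norm_num
  have h2 : log (1 + r ^ 2) + 1 = log ((1 + r ^ 2) * exp 1) := by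
    rw [Real.log_mul (by positivity) (by positivity), Real.log_exp]
  rw [h1, h2]
  constructor
  · apply Real.log_le_log (by positivity)
    have h3 := Real.add_one_le_exp 1
    nlinarith [sq_nonneg (r - 1), mul_nonneg (by positivity : 0 ≤ 1 + r ^ 2)
      (by linarith : (0:ℝ) ≤ exp 1 - 2)]
  · apply Real.log_le_log (by positivity)
    nlinarith

theorem kernelValue_le_exp {W r₀ r₁ r₂ w₀ w₁ w₂ : ℝ} (hW : 0 < W) (h0 : 0 < r₀) (h1 : 0 < r₁)
    (h2 : 0 < r₂) (hw0 : 0 < w₀) (hw1 : 0 < w₁) (hw2 : 0 < w₂) :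
    e.kernelValue W r₀ r₁ r₂ w₀ w₁ w₂ ≤ exp (2 + e.logKernel (log r₂) (log (1 + r₀))
      (log (1 + r₁)) (log (1 + r₂)) (log w₀) (log w₁) (log w₂) (log W)) := by
  have b0 := two_mul_log_one_add_le h0
  have b1 := two_mul_log_one_add_le h1
  have b2 := two_mul_log_one_add_le h2
  rw [kernelValue, logKernel, Real.rpow_def_of_pos hw0, Real.rpow_def_of_pos hw1,
    Real.rpow_def_of_pos hw2, Real.rpow_def_of_pos (by positivity : 0 < 1 + r₀ ^ 2),
    Real.rpow_def_of_pos (by positivity : 0 < 1 + r₁ ^ 2),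
    Real.rpow_def_of_pos (by positivity : 0 < 1 + r₂ ^ 2)]
  have e1 : (r₂ ^ 2)⁻¹ = exp (-(2 * log r₂)) := by
    rw [Real.exp_neg, two_mul, Real.exp_add, Real.exp_log h2, sq]
  have e2 : W ^ 2 = exp (2 * log W) := by
    rw [two_mul, Real.exp_add, Real.exp_log hW, sq]
  rw [e1, e2]
  simp only [← Real.exp_add]
  rw [Real.exp_le_exp]
  have := e.hs
  have := e.hs1
  have := e.hs'
  have := e.hs'_le
  have f0 : 0 ≤ (1 - e.s) * (log (1 + r₀ ^ 2) + 1 - 2 * log (1 + r₀)) :=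
    mul_nonneg (by linarith) (by linarith)
  have f1 : 0 ≤ e.s * (log (1 + r₁ ^ 2) + 1 - 2 * log (1 + r₁)) :=
    mul_nonneg (by linarith) (by linarith)
  have f2 : 0 ≤ e.s' * (log (1 + r₂ ^ 2) + 1 - 2 * log (1 + r₂)) :=
    mul_nonneg (by linarith) (by linarith)
  linarith

end Exponents

theorem log_le_log_add_one {x y : ℝ} (hx : 0 < x) (h : x ≤ 2 * y) : log x ≤ log y + 1 := by
  have hy : 0 < y := by linarith
  have h1 := Real.log_le_log hx h
  rw [Real.log_mul (by norm_num) hy.ne'] at h1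
  have := Real.log_two_lt_d9
  linarith

theorem two_mul_log_le {W x y z w : ℝ} (hW : 0 < W) (hx : 0 < x) (hy : 0 < y) (hz : 0 < z)
    (hw : 0 < w) (h : W ^ 2 ≤ 12 * (x * y * z) * w) :
    2 * log W ≤ 3 + log x + log y + log z + log w := by
  have h1 := Real.log_le_log (by positivity) h
  rw [Real.log_pow, Real.log_mul (by positivity) (by positivity),
    Real.log_mul (by norm_num) (by positivity), Real.log_mul (by positivity) (by positivity),
    Real.log_mul (by positivity) (by positivity)] at h1
  have h2 : log 12 ≤ 3 := by
    rw [Real.log_le_iff_le_exp (by norm_num)]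
    have h3 := Real.exp_one_gt_d9
    have h4 : exp 3 = exp 1 ^ 3 := by rw [← Real.exp_nat_mul]; norm_num
    rw [h4]
    calc (12 : ℝ) ≤ 2.7 ^ 3 := by norm_num
      _ ≤ exp 1 ^ 3 := by gcongr; linarith
  push_cast at h1
  linarith

namespace Exponents

variable (e : Exponents)

theorem kernelValue_le {W r₀ r₁ r₂ w₀ w₁ w₂ : ℝ} (hW : 0 < W) (h0 : 0 < r₀) (h1 : 0 < r₁)
    (h2 : 0 < r₂) (hw0 : 1 ≤ w₀) (hw1 : 1 ≤ w₁) (hw2 : 1 ≤ w₂)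
    (t0 : r₀ ≤ r₁ + r₂) (t1 : r₁ ≤ r₀ + r₂) (t2 : r₂ ≤ r₀ + r₁) (hWr : W ≤ r₀ * r₂)
    (hWw : ∀ w, w₀ ≤ w → w₁ ≤ w → w₂ ≤ w → W ^ 2 ≤ 12 * (r₀ * r₁ * r₂) * w) :
    (e.kernelValue W r₀ r₁ r₂ w₀ w₁ w₂ ≤ exp 20 * e.sizeValue W r₀ r₂ w₀ w₂ ∨
      e.kernelValue W r₀ r₁ r₂ w₀ w₁ w₂ ≤ exp 20 * e.sizeValue W r₀ r₁ w₀ w₁ ∨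
      e.kernelValue W r₀ r₁ r₂ w₀ w₁ w₂ ≤ exp 20 * e.orthoValue W r₀ r₁ r₂ w₁ w₂) ∨
    (e.kernelValue W r₀ r₁ r₂ w₀ w₁ w₂ ≤ exp 20 * e.sizeValue W r₁ r₂ w₁ w₂ ∨
      e.kernelValue W r₀ r₁ r₂ w₀ w₁ w₂ ≤ exp 20 * e.sizeValue W r₁ r₀ w₁ w₀ ∨
      e.kernelValue W r₀ r₁ r₂ w₀ w₁ w₂ ≤ exp 20 * e.orthoValue W r₁ r₀ r₂ w₀ w₂ ∨
      e.kernelValue W r₀ r₁ r₂ w₀ w₁ w₂ ≤ exp 20 * e.volumeValue r₁ w₂) ∨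
    (e.kernelValue W r₀ r₁ r₂ w₀ w₁ w₂ ≤ exp 20 * e.sizeValue W r₂ r₁ w₂ w₁ ∨
      e.kernelValue W r₀ r₁ r₂ w₀ w₁ w₂ ≤ exp 20 * e.sizeValue W r₂ r₀ w₂ w₀ ∨
      e.kernelValue W r₀ r₁ r₂ w₀ w₁ w₂ ≤ exp 20 * e.volumeValue r₂ w₁) := by
  have p0 : 0 < w₀ := by linarith
  have p1 : 0 < w₁ := by linarith
  have p2 : 0 < w₂ := by linarith
  have l0 := Real.log_nonneg hw0
  have l1 := Real.log_nonneg hw1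
  have l2 := Real.log_nonneg hw2
  have hk : 2 * log W ≤ 3 + log r₀ + log r₁ + log r₂ + log w₀ ∧
        log w₁ ≤ log w₀ ∧ log w₂ ≤ log w₀ ∨
      2 * log W ≤ 3 + log r₀ + log r₁ + log r₂ + log w₁ ∧ log w₀ ≤ log w₁ ∧ log w₂ ≤ log w₁ ∨
      2 * log W ≤ 3 + log r₀ + log r₁ + log r₂ + log w₂ ∧ log w₀ ≤ log w₂ ∧ log w₁ ≤ log w₂ := by
    rcases le_total w₀ w₁ with h01 | h01 <;> rcases le_total w₁ w₂ with h12 | h12 <;>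
      rcases le_total w₀ w₂ with h02 | h02 <;>
    first
    | exact .inl ⟨two_mul_log_le hW h0 h1 h2 p0 (hWw _ le_rfl (by linarith) (by linarith)),
        Real.log_le_log p1 (by linarith), Real.log_le_log p2 (by linarith)⟩
    | exact .inr (.inl ⟨two_mul_log_le hW h0 h1 h2 p1 (hWw _ (by linarith) le_rfl (by linarith)),
        Real.log_le_log p0 (by linarith), Real.log_le_log p2 (by linarith)⟩)
    | exact .inr (.inr ⟨two_mul_log_le hW h0 h1 h2 p2 (hWw _ (by linarith) (by linarith) le_rfl),
        Real.log_le_log p0 (by linarith), Real.log_le_log p1 (by linarith)⟩)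
  have hWl : log W ≤ log r₀ + log r₂ := by
    rw [← Real.log_mul h0.ne' h2.ne']; exact Real.log_le_log hW hWr
  have b0 : 0 ≤ log (1 + r₀) := Real.log_nonneg (by linarith)
  have b1 : 0 ≤ log (1 + r₁) := Real.log_nonneg (by linarith)
  have b2 : 0 ≤ log (1 + r₂) := Real.log_nonneg (by linarith)
  have c0 : log r₀ ≤ log (1 + r₀) := Real.log_le_log h0 (by linarith)
  have c1 : log r₁ ≤ log (1 + r₁) := Real.log_le_log h1 (by linarith)
  have c2 : log r₂ ≤ log (1 + r₂) := Real.log_le_log h2 (by linarith)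
  have key : ∀ {t : ℝ}, e.logKernel (log r₂) (log (1 + r₀)) (log (1 + r₁)) (log (1 + r₂))
      (log w₀) (log w₁) (log w₂) (log W) ≤ 18 + t →
      e.kernelValue W r₀ r₁ r₂ w₀ w₁ w₂ ≤ exp 20 * exp t := fun {t} h => by
    refine (e.kernelValue_le_exp hW h0 h1 h2 p0 p1 p2).trans ?_
    rw [← Real.exp_add]
    exact Real.exp_le_exp.2 (by linarith)
  have first_min : r₀ ≤ r₁ → r₀ ≤ r₂ → _ := fun h01 h02 =>
    e.logKernel_le_of_low_output b0 c0 c1 l0 l1 l2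
      (Real.log_le_log (by linarith) (by linarith : 1 + r₀ ≤ 1 + r₁))
      (Real.log_le_log (by linarith) (by linarith : 1 + r₀ ≤ 1 + r₂))
      (log_le_log_add_one h1 (by linarith : r₁ ≤ 2 * r₂)) hk
  have second_min : r₁ ≤ r₀ → r₁ ≤ r₂ → _ := fun h10 h12 =>
    e.logKernel_le_of_low_first b1 c1 c2 l0 l1 l2
      (Real.log_le_log (by linarith) (by linarith : 1 + r₁ ≤ 1 + r₀))
      (Real.log_le_log (by linarith) (by linarith : 1 + r₁ ≤ 1 + r₂))
      (log_le_log_add_one h0 (by linarith : r₀ ≤ 2 * r₂))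
      (log_le_log_add_one (by linarith) (by linarith : 1 + r₂ ≤ 2 * (1 + r₀))) hk
  have third_min : r₂ ≤ r₀ → r₂ ≤ r₁ → _ := fun h20 h21 =>
    e.logKernel_le_of_low_second b2 c0 l0 l1 l2 hWl
      (log_le_log_add_one h1 (by linarith : r₁ ≤ 2 * r₀))
      (log_le_log_add_one (by linarith) (by linarith : 1 + r₀ ≤ 2 * (1 + r₁))) hk
  rw [e.sizeValue_eq_exp hW h0 h2 p0 p2, e.sizeValue_eq_exp hW h0 h1 p0 p1,
    e.orthoValue_eq_exp hW h0 h1 h2 p1 p2, e.sizeValue_eq_exp hW h1 h2 p1 p2,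
    e.sizeValue_eq_exp hW h1 h0 p1 p0, e.orthoValue_eq_exp hW h1 h0 h2 p0 p2,
    e.volumeValue_eq_exp h1 p2, e.sizeValue_eq_exp hW h2 h1 p2 p1,
    e.sizeValue_eq_exp hW h2 h0 p2 p0, e.volumeValue_eq_exp h2 p1]
  rcases le_total r₀ r₁ with h01 | h01
  · rcases le_total r₀ r₂ with h02 | h02
    · exact .inl ((first_min h01 h02).imp key (Or.imp key key))
    · exact .inr (.inr ((third_min h02 (by linarith)).imp key (Or.imp key key)))
  · rcases le_total r₁ r₂ with h12 | h12
    · exact .inr (.inl ((second_min h01 h12).imp key (Or.imp key (Or.imp key key))))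
    · exact .inr (.inr ((third_min (by linarith) h12).imp key (Or.imp key key)))

theorem density_nonneg (ρ : ℝ) : 0 ≤ e.density ρ := by
  unfold density
  rcases le_or_gt 0 ρ with h | h
  · positivity
  · have h1 : cos (-(1 / 2) * π) = 0 := by
      rw [show -(1 / 2) * π = -(π / 2) by ring, Real.cos_neg, Real.cos_pi_div_two]
    rw [Real.rpow_def_of_neg h, h1]; simp

theorem measurable_density : Measurable e.density := by
  unfold density
  fun_prop

/-- The squared kernel of the null form. -/
def nullKernelSq (a b c : SpaceTime) : ℝ :=
  e.kernelValue (cross b c) (spFreq a) (spFreq b) (spFreq c) (coneWeight a) (coneWeight b)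
    (coneWeight c)

/-- The size kernel attached to the exponents. -/
def sizeKernel : SpaceTime → SpaceTime → SpaceTime → ℝ≥0∞ :=
  rootKernel (sizeKernelSq e.density e.p)

/-- The ortho kernel attached to the exponents. -/
def orthoKernel : SpaceTime → SpaceTime → SpaceTime → ℝ≥0∞ :=
  rootKernel (orthoKernelSq e.qO e.p)

/-- The volume kernel attached to the exponents. -/
def volumeKernel : SpaceTime → SpaceTime → SpaceTime → ℝ≥0∞ :=
  rootKernel (volumeKernelSq e.qV e.p)

/-- A sum of bounded kernels dominating the kernel of the null form. -/
def majorant (a b c : SpaceTime) : ℝ≥0∞ :=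
  e.sizeKernel a b c + (e.sizeKernel a c b + (e.sizeKernel b a c + (e.sizeKernel b c a +
    (e.sizeKernel c a b + (e.sizeKernel c b a + (e.orthoKernel a b c + (e.orthoKernel b a c +
      (e.volumeKernel a b c + e.volumeKernel a c b))))))))

theorem l2Bounded_majorant : L2Bounded e.majorant := by
  have mS := kernelMeasurable_sizeKernelSq e.measurable_density e.p
  have mO := kernelMeasurable_orthoKernelSq e.qO e.p
  have mV := kernelMeasurable_volumeKernelSq e.qV e.p
  have hS : L2Bounded e.sizeKernel := l2Bounded_sizeKernelSq e.measurable_density e.density_nonneg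
    e.hp (lintegral_singular_bracket_ne_top e.hη)
  have hO : L2Bounded e.orthoKernel := l2Bounded_orthoKernelSq e.hqO e.hp
  have hV : L2Bounded e.volumeKernel := l2Bounded_volumeKernelSq e.hqV e.hp
  exact .add mS hS (.add mS.rotate hS.rotate (.add mS.swap (hS.swap mS)
    (.add mS.rotate.swap (hS.rotate.swap mS.rotate)
    (.add mS.swap.rotate (hS.swap mS).rotate
    (.add mS.rotate.swap.rotate (hS.rotate.swap mS.rotate).rotate (.add mO hO (.add mO.swap (hO.swap mO) (.add mV hV hV.rotate))))))))

theorem rootKernel_nullKernelSq_le (a b : SpaceTime) :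
    rootKernel e.nullKernelSq a b (-(a + b)) ≤
      ENNReal.ofReal √(exp 20) * e.majorant a b (-(a + b)) := by
  set c := -(a + b) with hc
  have hbc : cross b c = cross a b := by
    rw [hc, add_comm, cross_neg_add, cross_comm]
  rcases (cross_nonneg a b).eq_or_lt with h0 | hW
  · rw [rootKernel, nullKernelSq, kernelValue, hbc, ← h0]
    simp
  have hac : cross a c = cross a b := cross_neg_add a b
  have pos : ∀ {x y : SpaceTime}, 0 < cross x y → 0 < spFreq x ∧ 0 < spFreq y := by
    intro x y h
    have h' := h.trans_le (cross_le x y)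
    have hx := spFreq_nonneg x
    have hy := spFreq_nonneg y
    exact ⟨hx.lt_of_ne (by rintro h; simp [← h] at h'), hy.lt_of_ne (by rintro h; simp [← h] at h')⟩
  obtain ⟨ra, rb⟩ := pos hW
  have rc := (pos (hbc ▸ hW)).2
  have tc : spFreq c ≤ spFreq a + spFreq b := by
    rw [hc, spFreq_neg]; exact spFreq_add_le a b
  have tbc := abs_le.1 (abs_spFreq_sub_le a b)
  rw [← hc] at tbc
  have main := e.kernelValue_le hW ra rb rc (one_le_coneWeight a) (one_le_coneWeight b)
    (one_le_coneWeight c) (by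
      have := spFreq_add_le (a + b) (-b)
      rw [spFreq_neg, add_neg_cancel_right] at this
      rw [hc, spFreq_neg]; linarith) (by linarith) tc (hac ▸ cross_le a c)
    fun w ha hb hcw => cross_sq_le a b ha hb hcw
  have key : ∀ {Q : ℝ} {M : ℝ≥0∞}, e.nullKernelSq a b c ≤ exp 20 * Q → ENNReal.ofReal √Q ≤ M →
      rootKernel e.nullKernelSq a b c ≤ ENNReal.ofReal √(exp 20) * M := by
    intro Q M h1 h2
    calc rootKernel e.nullKernelSq a b c ≤ ENNReal.ofReal √(exp 20 * Q) :=
          ENNReal.ofReal_le_ofReal (Real.sqrt_le_sqrt h1)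
      _ = ENNReal.ofReal √(exp 20) * ENNReal.ofReal √Q := by
          rw [Real.sqrt_mul (Real.exp_nonneg 20), ENNReal.ofReal_mul (Real.sqrt_nonneg _)]
      _ ≤ _ := by gcongr
  have hS : ∀ x y z : SpaceTime, cross x y = cross a b → ENNReal.ofReal √(e.sizeValue (cross a b)
      (spFreq y) (spFreq z) (coneWeight y) (coneWeight z)) = e.sizeKernel x y z := by
    intro x y z h
    rw [← h]; rfl
  have hO : ∀ x y z : SpaceTime, cross x y = cross a b → ENNReal.ofReal √(e.orthoValue (cross a b)
      (spFreq x) (spFreq y) (spFreq z) (coneWeight y) (coneWeight z)) = e.orthoKernel x y z := by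
    intro x y z h
    rw [← h]; rfl
  have hV : ∀ x y z : SpaceTime, ENNReal.ofReal √(e.volumeValue (spFreq y) (coneWeight z)) =
      e.volumeKernel x y z := fun _ _ _ => rfl
  have hba : cross b a = cross a b := cross_comm b a
  have hcb : cross c b = cross a b := (cross_comm c b).trans hbc
  have hca : cross c a = cross a b := (cross_comm c a).trans hac
  have hnull : e.nullKernelSq a b c = e.kernelValue (cross a b) (spFreq a) (spFreq b) (spFreq c)
      (coneWeight a) (coneWeight b) (coneWeight c) := by
    rw [← hbc]; rfl
  rw [← hnull] at main
  rcases main with (h | h | h) | (h | h | h | h) | (h | h | h)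
  · refine key h ((hS b a c hba).trans_le ?_)
    rw [majorant]
    repeat first
      | exact le_rfl
      | exact le_self_add
      | refine le_add_left ?_
  · refine key h ((hS c a b hca).trans_le ?_)
    rw [majorant]
    repeat first
      | exact le_rfl
      | exact le_self_add
      | refine le_add_left ?_
  · refine key h ((hO a b c rfl).trans_le ?_)
    rw [majorant]
    repeat first
      | exact le_rfl
      | exact le_self_add
      | refine le_add_left ?_
  · refine key h ((hS a b c rfl).trans_le ?_)
    rw [majorant]
    repeat first
      | exact le_rfl
      | exact le_self_add
      | refine le_add_left ?_
  · refine key h ((hS c b a hcb).trans_le ?_)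
    rw [majorant]
    repeat first
      | exact le_rfl
      | exact le_self_add
      | refine le_add_left ?_
  · refine key h ((hO b a c hba).trans_le ?_)
    rw [majorant]
    repeat first
      | exact le_rfl
      | exact le_self_add
      | refine le_add_left ?_
  · refine key h ((hV a b c).trans_le ?_)
    rw [majorant]
    repeat first
      | exact le_rfl
      | exact le_self_add
      | refine le_add_left ?_
  · refine key h ((hS a c b hac).trans_le ?_)
    rw [majorant]
    repeat first
      | exact le_rfl
      | exact le_self_add
      | refine le_add_left ?_
  · refine key h ((hS b c a hbc).trans_le ?_)
    rw [majorant]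
    repeat first
      | exact le_rfl
      | exact le_self_add
      | refine le_add_left ?_
  · refine key h ((hV a c b).trans_le ?_)
    rw [majorant]
    repeat first
      | exact le_rfl
      | exact le_self_add
      | refine le_add_left ?_

theorem l2Bounded_nullKernelSq : L2Bounded (rootKernel e.nullKernelSq) :=
  e.l2Bounded_majorant.mono ENNReal.ofReal_ne_top e.rootKernel_nullKernelSq_le

end Exponents

theorem fourier_mul_fourierInv {g h : SpaceTime → ℂ} (hg : Integrable g) (hh : Integrable h)
    (ζ : SpaceTime) :
    𝓕 (fun x => g x * 𝓕⁻ h x) ζ = ∫ η, 𝓕 g (ζ - η) * h η := by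
  have hG : Integrable fun x => 𝐞 (-inner ℝ x ζ) • g x :=
    (Real.fourierIntegral_convergent_iff ζ).2 hg
  have hL : Continuous fun p : SpaceTime × SpaceTime => (-innerₗ SpaceTime) p.1 p.2 := by
    simp only [LinearMap.neg_apply, innerₗ_apply_apply]
    fun_prop
  have key := VectorFourier.integral_fourierIntegral_smul_eq_flip (μ := volume) (ν := volume)
    (L := -innerₗ SpaceTime) Real.continuous_fourierChar hL hh hG
  calc 𝓕 (fun x => g x * 𝓕⁻ h x) ζ
      = ∫ x, VectorFourier.fourierIntegral 𝐞 volume (-innerₗ SpaceTime) h x •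
          (𝐞 (-inner ℝ x ζ) • g x) := by
        rw [Real.fourier_eq]
        refine integral_congr_ae (.of_forall fun x => ?_)
        simp only [Circle.smul_def, smul_eq_mul]
        change _ = 𝓕⁻ h x * _
        ring
    _ = _ := key
    _ = _ := by
        refine integral_congr_ae (.of_forall fun η => ?_)
        simp only [smul_eq_mul]
        rw [mul_comm]
        congr 1
        rw [Real.fourier_eq, VectorFourier.fourierIntegral]
        refine integral_congr_ae (.of_forall fun x => ?_)
        simp only [LinearMap.flip_apply, LinearMap.neg_apply, innerₗ_apply_apply, neg_neg]
        rw [smul_smul, ← AddChar.map_add_eq_mul]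
        congr 2
        rw [inner_sub_right, real_inner_comm]
        ring

theorem fourier_pd (j : Fin 3) (u : SchwartzMap SpaceTime ℂ) (ζ : SpaceTime) :
    𝓕 (pd j u) ζ = 2 * π * Complex.I * (ζ j) * 𝓕 (⇑u) ζ := by
  have h := congrArg (fun f : SchwartzMap SpaceTime ℂ => f ζ)
    (SchwartzMap.fourier_lineDerivOp_eq u (EuclideanSpace.single j (1 : ℝ)))
  have : (inner ℝ · (EuclideanSpace.single j (1 : ℝ)) : SpaceTime → ℝ).HasTemperateGrowth := by
    fun_prop
  simp only [smul_apply, SchwartzMap.smulLeftCLM_apply_apply this,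
    SchwartzMap.fourier_coe, smul_eq_mul] at h
  have h2 : (⇑(LineDeriv.lineDerivOp (EuclideanSpace.single j (1 : ℝ)) u) : SpaceTime → ℂ) =
      pd j u := by
    ext x
    rw [SchwartzMap.lineDerivOp_apply_eq_fderiv]; rfl
  rw [h2] at h
  rw [h]
  simp only [EuclideanSpace.inner_single_right, Complex.real_smul]
  simp
  ring

theorem integrable_pd (j : Fin 3) (u : SchwartzMap SpaceTime ℂ) : Integrable (pd j u) := by
  have h2 : (⇑(LineDeriv.lineDerivOp (EuclideanSpace.single j (1 : ℝ)) u) : SpaceTime → ℂ) =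
      pd j u := by
    ext x
    rw [SchwartzMap.lineDerivOp_apply_eq_fderiv]; rfl
  rw [← h2]
  exact SchwartzMap.integrable _

theorem abs_apply_le_spFreq {j : Fin 3} (hj : j = 1 ∨ j = 2) (ζ : SpaceTime) :
    |ζ j| ≤ spFreq ζ := by
  apply Real.abs_le_sqrt
  rcases hj with rfl | rfl <;> nlinarith [sq_nonneg (ζ 1), sq_nonneg (ζ 2)]

/-- The Fourier transform of `∂ⱼ D⁻¹ v`. -/
def rieszFourier (j : Fin 3) (v : SpaceTime → ℂ) (ζ : SpaceTime) : ℂ :=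
  Complex.I * (ζ j : ℂ) * ((spFreq ζ : ℝ) : ℂ)⁻¹ * 𝓕 v ζ

theorem integrable_rieszFourier {j : Fin 3} (hj : j = 1 ∨ j = 2) (v : SchwartzMap SpaceTime ℂ) :
    Integrable (rieszFourier j v) := by
  have hv : Integrable (𝓕 (⇑v)) := by
    rw [← SchwartzMap.fourier_coe]; exact SchwartzMap.integrable _
  refine Integrable.bdd_mul (c := 1) hv ?_ (.of_forall fun ζ => ?_)
  · have := measurable_spFreq
    exact Measurable.aestronglyMeasurable (by fun_prop)
  · have h := abs_apply_le_spFreq hj ζ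
    rw [norm_mul, norm_mul, norm_inv, Complex.norm_I, Complex.norm_real, Complex.norm_real, one_mul,
      Real.norm_eq_abs, Real.norm_of_nonneg (spFreq_nonneg ζ)]
    exact div_le_one_of_le₀ h (spFreq_nonneg ζ)

theorem integrable_mul_fourierInv {g h : SpaceTime → ℂ} (hg : Integrable g) (hh : Integrable h) :
    Integrable fun x => g x * 𝓕⁻ h x := by
  have hc : Continuous (𝓕⁻ h) := VectorFourier.fourierIntegral_continuous
    Real.continuous_fourierChar (L := -innerₗ SpaceTime) (by
      simp only [LinearMap.neg_apply, innerₗ_apply_apply]; fun_prop) hh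
  refine Integrable.mul_bdd (c := ∫ x, ‖h x‖) hg hc.aestronglyMeasurable (.of_forall fun x => ?_)
  exact VectorFourier.norm_fourierIntegral_le_integral_norm _ _ _ _ _

theorem integrable_fourier_mul {g h : SpaceTime → ℂ} (hg : Integrable g) (hh : Integrable h)
    (ζ : SpaceTime) : Integrable fun η => 𝓕 g (ζ - η) * h η := by
  have hc : Continuous (𝓕 g) := VectorFourier.fourierIntegral_continuous
    Real.continuous_fourierChar (L := innerₗ SpaceTime) (by
      simp only [innerₗ_apply_apply]; fun_prop) hg
  refine Integrable.bdd_mul (c := ∫ x, ‖g x‖) hh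
    (hc.comp (by fun_prop : Continuous fun η => ζ - η)).aestronglyMeasurable (.of_forall fun x => ?_)
  exact VectorFourier.norm_fourierIntegral_le_integral_norm _ _ _ _ _

theorem abs_minor_le_cross {j k : Fin 3} (hj : j = 1 ∨ j = 2) (hk : k = 1 ∨ k = 2)
    (a b : SpaceTime) : |a j * b k - a k * b j| ≤ cross a b := by
  rcases hj with rfl | rfl <;> rcases hk with rfl | rfl
  · rw [sub_self, abs_zero]; exact cross_nonneg a b
  · exact le_rfl
  · rw [abs_sub_comm]; exact le_rfl
  · rw [sub_self, abs_zero]; exact cross_nonneg a b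

/-- The null form `Q_{jk}(u, D⁻¹ v)`. -/
def nullForm (j k : Fin 3) (u v : SpaceTime → ℂ) (x : SpaceTime) : ℂ :=
  pd j u x * pdDinv k v x - pd k u x * pdDinv j v x

theorem enorm_fourier_nullForm_le {j k : Fin 3} (hj : j = 1 ∨ j = 2) (hk : k = 1 ∨ k = 2)
    (u v : SchwartzMap SpaceTime ℂ) (ζ : SpaceTime) :
    ‖𝓕 (nullForm j k u v) ζ‖ₑ ≤ ENNReal.ofReal (2 * π) *
      ∫⁻ η, ENNReal.ofReal (cross (ζ - η) η * (spFreq η)⁻¹) *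
        (‖𝓕 (⇑u) (ζ - η)‖ₑ * ‖𝓕 (⇑v) η‖ₑ) := by
  have pj := integrable_pd j u
  have pk := integrable_pd k u
  have rj := integrable_rieszFourier hj v
  have rk := integrable_rieszFourier hk v
  have h1 : 𝓕 (nullForm j k u v) ζ = ∫ η, (𝓕 (pd j u) (ζ - η) * rieszFourier k v η -
      𝓕 (pd k u) (ζ - η) * rieszFourier j v η) := by
    rw [integral_sub (integrable_fourier_mul pj rk ζ) (integrable_fourier_mul pk rj ζ),
      ← fourier_mul_fourierInv pj rk, ← fourier_mul_fourierInv pk rj,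
      Real.fourier_eq, Real.fourier_eq, Real.fourier_eq, ← integral_sub
        ((Real.fourierIntegral_convergent_iff ζ).2 (integrable_mul_fourierInv pj rk))
        ((Real.fourierIntegral_convergent_iff ζ).2 (integrable_mul_fourierInv pk rj))]
    refine integral_congr_ae (.of_forall fun x => ?_)
    exact smul_sub _ _ _
  rw [h1, ← lintegral_const_mul' _ _ ENNReal.ofReal_ne_top]
  refine (enorm_integral_le_lintegral_enorm _).trans (lintegral_mono fun η => ?_)
  have h2 : 𝓕 (pd j u) (ζ - η) * rieszFourier k v η - 𝓕 (pd k u) (ζ - η) * rieszFourier j v η =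
      ((-(2 * π) * (((ζ - η) j * η k - (ζ - η) k * η j) * (spFreq η)⁻¹) : ℝ) : ℂ) *
        (𝓕 (⇑u) (ζ - η) * 𝓕 (⇑v) η) := by
    rw [fourier_pd, fourier_pd, rieszFourier, rieszFourier]
    push_cast
    linear_combination (2 * π * (spFreq η : ℂ)⁻¹ * 𝓕 (⇑u) (ζ - η) * 𝓕 (⇑v) η *
      ((ζ - η) j * η k - (ζ - η) k * η j)) * Complex.I_sq
  rw [h2, enorm_mul, enorm_mul, ← mul_assoc (ENNReal.ofReal (2 * π)), ← ENNReal.ofReal_mul (by positivity)]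
  gcongr
  rw [← ofReal_norm, Complex.norm_real, Real.norm_eq_abs]
  refine ENNReal.ofReal_le_ofReal ?_
  have h3 := inv_nonneg.2 (spFreq_nonneg η)
  rw [abs_mul, abs_mul, abs_neg, abs_of_pos (by positivity : 0 < 2 * π), abs_of_nonneg h3]
  gcongr
  exact abs_minor_le_cross hj hk _ _

/-- The weight of the wave-Sobolev norm. -/
def waveWeight (s b : ℝ) (ζ : SpaceTime) : ℝ :=
  (1 + spFreq ζ ^ 2) ^ s * coneWeight ζ ^ (2 * b)

theorem waveWeight_pos (s b : ℝ) (ζ : SpaceTime) : 0 < waveWeight s b ζ := by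
  have := coneWeight_pos ζ
  unfold waveWeight
  positivity

theorem measurable_waveWeight (s b : ℝ) : Measurable (waveWeight s b) := by
  have := measurable_spFreq
  have := measurable_coneWeight
  unfold waveWeight
  fun_prop

/-- The Fourier transform weighted by the square root of the wave-Sobolev weight. -/
def weightedFourier (s b : ℝ) (f : SpaceTime → ℂ) (ζ : SpaceTime) : ℝ≥0∞ :=
  ENNReal.ofReal √(waveWeight s b ζ) * ‖𝓕 f ζ‖ₑ

theorem weightedFourier_sq (s b : ℝ) (f : SpaceTime → ℂ) (ζ : SpaceTime) :
    weightedFourier s b f ζ ^ 2 = ENNReal.ofReal (waveWeight s b ζ * ‖𝓕 f ζ‖ ^ 2) := by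
  rw [weightedFourier, mul_pow, ofReal_sqrt_sq, ENNReal.ofReal_mul (waveWeight_pos s b ζ).le,
    ENNReal.ofReal_pow (norm_nonneg _), ofReal_norm]

theorem continuous_fourier {f : SpaceTime → ℂ} (hf : Integrable f) : Continuous (𝓕 f) :=
  VectorFourier.fourierIntegral_continuous Real.continuous_fourierChar (L := innerₗ SpaceTime) (by
    simp only [innerₗ_apply_apply]; fun_prop) hf

theorem measurable_weightedFourier (s b : ℝ) {f : SpaceTime → ℂ} (hf : Integrable f) :
    Measurable (weightedFourier s b f) :=
  (measurable_waveWeight s b).sqrt.ennreal_ofReal.mul (continuous_fourier hf).measurable.enorm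

theorem waveNorm_eq (s b : ℝ) (f : SpaceTime → ℂ) :
    waveNorm s b f = (∫ ζ, waveWeight s b ζ * ‖𝓕 f ζ‖ ^ 2) ^ (1 / 2 : ℝ) := rfl

theorem ofReal_waveNorm_le (s b : ℝ) (f : SpaceTime → ℂ) :
    ENNReal.ofReal (waveNorm s b f) ≤ l2 (weightedFourier s b f) := by
  have h0 : ∀ ζ, 0 ≤ waveWeight s b ζ * ‖𝓕 f ζ‖ ^ 2 := fun ζ =>
    mul_nonneg (waveWeight_pos s b ζ).le (by positivity)
  rw [l2, waveNorm_eq, ← ENNReal.ofReal_rpow_of_nonneg (integral_nonneg h0) (by norm_num)]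
  simp only [weightedFourier_sq]
  gcongr
  calc ENNReal.ofReal (∫ ζ, waveWeight s b ζ * ‖𝓕 f ζ‖ ^ 2)
      = ‖∫ ζ, waveWeight s b ζ * ‖𝓕 f ζ‖ ^ 2‖ₑ := (Real.enorm_of_nonneg (integral_nonneg h0)).symm
    _ ≤ ∫⁻ ζ, ‖waveWeight s b ζ * ‖𝓕 f ζ‖ ^ 2‖ₑ := enorm_integral_le_lintegral_enorm _
    _ = _ := lintegral_congr fun ζ => Real.enorm_of_nonneg (h0 ζ)

theorem spFreq_le_norm (ζ : SpaceTime) : spFreq ζ ≤ ‖ζ‖ := by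
  rw [EuclideanSpace.norm_eq, Fin.sum_univ_three, spFreq]
  apply Real.sqrt_le_sqrt
  simp only [Real.norm_eq_abs, sq_abs]
  nlinarith [sq_nonneg (ζ 0)]

theorem coneWeight_le_norm (ζ : SpaceTime) : coneWeight ζ ≤ 1 + ‖ζ‖ := by
  have h1 := spFreq_le_norm ζ
  have h2 := spFreq_nonneg ζ
  have h3 : |ζ 0| ≤ ‖ζ‖ := PiLp.norm_apply_le ζ 0
  have h4 := abs_nonneg (ζ 0)
  rw [coneWeight]
  gcongr
  exact abs_le.2 ⟨by linarith, by linarith⟩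

theorem waveWeight_le_norm {s b : ℝ} (hs : s ≤ 1) (hb : b ≤ 1) (ζ : SpaceTime) :
    waveWeight s b ζ ≤ 8 * (1 + ‖ζ‖ ^ 4) := by
  have h1 := spFreq_le_norm ζ
  have h2 := spFreq_nonneg ζ
  have h3 := coneWeight_le_norm ζ
  have h4 := one_le_coneWeight ζ
  have hn := norm_nonneg ζ
  calc waveWeight s b ζ ≤ (1 + spFreq ζ ^ 2) ^ (1 : ℝ) * coneWeight ζ ^ (2 : ℝ) := by
        unfold waveWeight
        gcongr
        · nlinarith
        · linarith
    _ = (1 + spFreq ζ ^ 2) * coneWeight ζ ^ 2 := by rw [Real.rpow_one, Real.rpow_two]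
    _ ≤ (1 + ‖ζ‖ ^ 2) * (1 + ‖ζ‖) ^ 2 := by gcongr
    _ ≤ 8 * (1 + ‖ζ‖ ^ 4) := by
        nlinarith [sq_nonneg (‖ζ‖ - 1), sq_nonneg (‖ζ‖ ^ 2 - 1), sq_nonneg (‖ζ‖ ^ 2 - ‖ζ‖)]

theorem l2_weightedFourier {s b : ℝ} (hs : s ≤ 1) (hb : b ≤ 1) (u : SchwartzMap SpaceTime ℂ) :
    l2 (weightedFourier s b u) = ENNReal.ofReal (waveNorm s b u) := by
  have h0 : ∀ ζ, 0 ≤ waveWeight s b ζ * ‖𝓕 (⇑u) ζ‖ ^ 2 := fun ζ =>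
    mul_nonneg (waveWeight_pos s b ζ).le (by positivity)
  have hi : Integrable fun ζ => waveWeight s b ζ * ‖𝓕 (⇑u) ζ‖ ^ 2 := by
    obtain ⟨C, hC⟩ : ∃ C, ∀ ζ, ‖𝓕 (⇑u) ζ‖ ≤ C :=
      ⟨∫ x, ‖u x‖, VectorFourier.norm_fourierIntegral_le_integral_norm _ _ _ _⟩
    have hm := (SchwartzMap.integrable (μ := volume) (𝓕 u)).norm
    have hm4 := SchwartzMap.integrable_pow_mul volume (𝓕 u) 4
    rw [SchwartzMap.fourier_coe] at hm hm4
    have hc := continuous_fourier (SchwartzMap.integrable (μ := volume) u)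
    refine ((hm.add hm4).const_mul (8 * C)).mono' ?_ (.of_forall fun ζ => ?_)
    · exact ((measurable_waveWeight s b).mul (hc.measurable.norm.pow_const 2)).aestronglyMeasurable
    · rw [Real.norm_of_nonneg (h0 ζ)]
      calc waveWeight s b ζ * ‖𝓕 (⇑u) ζ‖ ^ 2
          ≤ (8 * (1 + ‖ζ‖ ^ 4)) * (C * ‖𝓕 (⇑u) ζ‖) := by
            rw [sq]
            gcongr
            · exact waveWeight_le_norm hs hb ζ
            · exact hC ζ
        _ = _ := by simp only [Pi.add_apply]; ring
  rw [l2, waveNorm_eq, ← ENNReal.ofReal_rpow_of_nonneg (integral_nonneg h0) (by norm_num)]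
  simp only [weightedFourier_sq]
  congr 1
  exact (ofReal_integral_eq_lintegral_ofReal hi (.of_forall h0)).symm

theorem l2_comp_neg (f : SpaceTime → ℝ≥0∞) : l2 (fun x => f (-x)) = l2 f := by
  rw [l2, l2, lintegral_neg_eq_self (fun x => f x ^ 2)]

theorem waveWeight_neg (s b : ℝ) (ζ : SpaceTime) : waveWeight s b (-ζ) = waveWeight s b ζ := by
  rw [waveWeight, waveWeight, spFreq_neg, coneWeight_neg]

namespace Exponents

variable (e : Exponents)

theorem sqrt_waveWeight_mul_cross (a b c : SpaceTime) :
    √(waveWeight (e.s - 1) (-e.β) a) * (cross b c * (spFreq c)⁻¹) =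
      √(e.nullKernelSq a b c) * (√(waveWeight e.s e.θ₀ b) * √(waveWeight e.s' e.θ₁ c)) := by
  have hr := spFreq_nonneg c
  have hX := cross_nonneg b c
  have hw : ∀ x : SpaceTime, 0 < coneWeight x := coneWeight_pos
  have ha := hw a
  have hb := hw b
  have hc := hw c
  have h1 := waveWeight_pos e.s e.θ₀ b
  have h2 := waveWeight_pos e.s' e.θ₁ c
  have h3 := waveWeight_pos (e.s - 1) (-e.β) a
  have hk : 0 ≤ e.nullKernelSq a b c := by
    unfold nullKernelSq kernelValue
    positivity
  rw [← Real.sqrt_sq (by positivity : 0 ≤ cross b c * (spFreq c)⁻¹), ← Real.sqrt_mul h3.le,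
    ← Real.sqrt_mul h1.le, ← Real.sqrt_mul hk]
  congr 1
  simp only [nullKernelSq, kernelValue, waveWeight]
  rw [Real.rpow_neg (by positivity) e.s, Real.rpow_neg (by positivity) e.s',
    Real.rpow_neg hb.le (2 * e.θ₀), Real.rpow_neg hc.le (2 * e.θ₁), mul_neg]
  have p1 : (1 + spFreq b ^ 2) ^ e.s ≠ 0 := (Real.rpow_pos_of_pos (by positivity) _).ne'
  have p2 : (1 + spFreq c ^ 2) ^ e.s' ≠ 0 := (Real.rpow_pos_of_pos (by positivity) _).ne'
  have p3 : coneWeight b ^ (2 * e.θ₀) ≠ 0 := (Real.rpow_pos_of_pos (by positivity) _).ne'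
  have p4 : coneWeight c ^ (2 * e.θ₁) ≠ 0 := (Real.rpow_pos_of_pos (by positivity) _).ne'
  field_simp

theorem l2_nullForm_le : ∃ C : ℝ≥0∞, C ≠ ∞ ∧ ∀ (u v : SchwartzMap SpaceTime ℂ) (j k : Fin 3),
    (j = 1 ∨ j = 2) → (k = 1 ∨ k = 2) →
    l2 (weightedFourier (e.s - 1) (-e.β) (nullForm j k u v)) ≤
      C * (l2 (weightedFourier e.s e.θ₀ u) * l2 (weightedFourier e.s' e.θ₁ v)) := by
  obtain ⟨C, hC, h⟩ := e.l2Bounded_nullKernelSq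
  refine ⟨ENNReal.ofReal (2 * π) * C, ENNReal.mul_ne_top ENNReal.ofReal_ne_top hC,
    fun u v j k hj hk => ?_⟩
  have hQ : Integrable (nullForm j k u v) :=
    (integrable_mul_fourierInv (integrable_pd j u) (integrable_rieszFourier hk v)).sub
      (integrable_mul_fourierInv (integrable_pd k u) (integrable_rieszFourier hj v))
  have mu := measurable_weightedFourier e.s e.θ₀ (SchwartzMap.integrable (μ := volume) u)
  have mv := measurable_weightedFourier e.s' e.θ₁ (SchwartzMap.integrable (μ := volume) v)
  refine l2_le_of_pairing (measurable_weightedFourier _ _ hQ) fun g hg => ?_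
  have htri := h g (fun b => weightedFourier e.s e.θ₀ u (-b))
    (fun c => weightedFourier e.s' e.θ₁ v (-c)) hg (by fun_prop) (by fun_prop)
  rw [l2_comp_neg, l2_comp_neg] at htri
  calc ∫⁻ a, weightedFourier (e.s - 1) (-e.β) (nullForm j k u v) a * g a
      ≤ ∫⁻ a, ENNReal.ofReal (2 * π) * ∫⁻ b, rootKernel e.nullKernelSq a b (-(a + b)) * (g a *
          weightedFourier e.s e.θ₀ u (-b) * weightedFourier e.s' e.θ₁ v (-(-(a + b)))) := by
        refine lintegral_mono fun a => ?_
        have hf := enorm_fourier_nullForm_le hj hk u v a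
        rw [← lintegral_add_right_eq_self _ a] at hf
        have hpt : ∀ b, ENNReal.ofReal √(waveWeight (e.s - 1) (-e.β) a) * g a *
            (ENNReal.ofReal (cross (a - (b + a)) (b + a) * (spFreq (b + a))⁻¹) *
              (‖𝓕 (⇑u) (a - (b + a))‖ₑ * ‖𝓕 (⇑v) (b + a)‖ₑ)) =
            rootKernel e.nullKernelSq a b (-(a + b)) * (g a *
              weightedFourier e.s e.θ₀ u (-b) * weightedFourier e.s' e.θ₁ v (-(-(a + b)))) := by
          intro b
          have h1 : a - (b + a) = -b := by abel
          have h2 : b + a = -(-(a + b)) := by abel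
          rw [h1, h2]
          generalize -(a + b) = c
          have h3 : cross (-b) (-c) = cross b c := by simp [cross]
          have h4 := congrArg ENNReal.ofReal (e.sqrt_waveWeight_mul_cross a b c)
          rw [ENNReal.ofReal_mul (Real.sqrt_nonneg _), ENNReal.ofReal_mul (Real.sqrt_nonneg _),
            ENNReal.ofReal_mul (Real.sqrt_nonneg _)] at h4
          rw [h3, spFreq_neg, weightedFourier, weightedFourier, waveWeight_neg, waveWeight_neg,
            rootKernel]
          calc _ = ENNReal.ofReal √(waveWeight (e.s - 1) (-e.β) a) *
                ENNReal.ofReal (cross b c * (spFreq c)⁻¹) *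
                (g a * ‖𝓕 (⇑u) (-b)‖ₑ * ‖𝓕 (⇑v) (-c)‖ₑ) := by ring
            _ = _ := by rw [h4]; ring
        simp only [← hpt]
        refine le_trans ?_ (mul_le_mul_right (lintegral_const_mul_le _ _) _)
        calc weightedFourier (e.s - 1) (-e.β) (nullForm j k u v) a * g a
            = ENNReal.ofReal √(waveWeight (e.s - 1) (-e.β) a) * g a *
                ‖𝓕 (nullForm j k u v) a‖ₑ := by rw [weightedFourier, mul_right_comm]
          _ ≤ _ := mul_le_mul_right hf _
          _ = _ := by ring
    _ = ENNReal.ofReal (2 * π) * triForm (rootKernel e.nullKernelSq) g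
          (fun b => weightedFourier e.s e.θ₀ u (-b))
          (fun c => weightedFourier e.s' e.θ₁ v (-c)) :=
        lintegral_const_mul' _ _ ENNReal.ofReal_ne_top
    _ ≤ ENNReal.ofReal (2 * π) * (C * (l2 g * l2 (weightedFourier e.s e.θ₀ u) *
          l2 (weightedFourier e.s' e.θ₁ v))) := by gcongr
    _ = _ := by ring

end Exponents

theorem waveNorm_nonneg (s b : ℝ) (f : SpaceTime → ℂ) : 0 ≤ waveNorm s b f :=
  Real.rpow_nonneg (integral_nonneg fun ζ =>
    mul_nonneg (waveWeight_pos s b ζ).le (by positivity)) _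

/-- The estimate `‖Q_{jk}(u, D^{-1}v)‖_{H^{s-1, θ₀-1+ε}} ≲ ‖u‖_{H^{s,θ₀}} ‖v‖_{H^{s',θ₁}}`,
where `Q_{jk}(u, D^{-1}v) = ∂_j u · ∂_k(D^{-1}v) − ∂_k u · ∂_j(D^{-1}v)`. -/
theorem nullform_Q_Dinv_estimate (s s' θ₀ θ₁ : ℝ)
    (hs1 : 1/4 < s') (hs2 : s' ≤ 1) (hs3 : 1/2 < s) (hs4 : s ≤ 1)
    (hs5 : max (3/2 - 2 * s) (s/2 - 1/8) < s') (hs6 : s' < 4 * s - 3/2)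
    (hθ0 : 1/2 < θ₀) (hθ0b : θ₀ < 3/4)
    (hθ1 : max (1/2) (1 - s') < θ₁)
    (hθ1b : θ₁ < min (3/4) (min (4 * s - s' - 1) (2 * s - 1/2))) :
    ∃ ε₀ > 0, ∀ ε : ℝ, 0 < ε → ε ≤ ε₀ → ∃ C > 0,
      ∀ (u v : SchwartzMap SpaceTime ℂ) (j k : Fin 3),
        (j = 1 ∨ j = 2) → (k = 1 ∨ k = 2) →
        waveNorm (s - 1) (θ₀ - 1 + ε)
          (fun x => pd j (fun y => u y) x * pdDinv k (fun y => v y) x -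
            pd k (fun y => u y) x * pdDinv j (fun y => v y) x) ≤
          C * waveNorm s θ₀ (fun x => u x) * waveNorm s' θ₁ (fun x => v x) := by
  obtain ⟨h5a, h5b⟩ := max_lt_iff.1 hs5
  obtain ⟨h1a, h1b⟩ := max_lt_iff.1 hθ1
  obtain ⟨h2a, h2b⟩ := lt_min_iff.1 hθ1b
  refine ⟨(3 / 4 - θ₀) / 2, by linarith, fun ε hε hε₀ => ?_⟩
  obtain ⟨p, hp, hpb⟩ : ∃ p, 1 < p ∧ p < min (1 + (3 / 4 - θ₀))
      (min (2 * θ₀) (min (2 * θ₁) (2 * s' + 2 * θ₁ - 1))) :=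
    exists_between (lt_min (by linarith) (lt_min (by linarith) (lt_min (by linarith)
      (by linarith))))
  obtain ⟨hp1, hpb⟩ := lt_min_iff.1 hpb
  obtain ⟨hp2, hpb⟩ := lt_min_iff.1 hpb
  obtain ⟨hp3, hp4⟩ := lt_min_iff.1 hpb
  let e : Exponents :=
    { s := s, s' := s', β := 1 - θ₀ - ε, θ₀ := θ₀, θ₁ := θ₁, p := p
      η := min (2 * s') (2 * s' + 2 * θ₁ - 1 / 2 - p)
      qO := min (1 / 2 + 2 * s') (3 / 2 + 4 * s' - 2 * s)
      qV := min (3 + 4 * s' - 2 * s) (2 * s' + 2 * θ₁)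
      hs := hs3, hs1 := hs4, hs' := hs1, hs'_le := hs2
      hβ := by linarith
      hp := hp
      hpθ₀ := hp2.le
      hpθ₁ := hp3.le
      hθ₁ := h2a
      hpβ := by linarith
      hpβ₀ := by linarith
      hpβ₁ := by linarith
      hη := lt_min (by linarith) (by linarith)
      hηs := min_le_left _ _
      hηp := min_le_right _ _
      hqO := lt_min (by linarith) (by linarith)
      hqO1 := min_le_left _ _
      hqO2 := min_le_right _ _
      hqV := lt_min (by linarith) (by linarith)
      hqV1 := min_le_left _ _
      hqV2 := min_le_right _ _ }
  obtain ⟨C, hC, h⟩ := e.l2_nullForm_le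
  refine ⟨C.toReal + 1, by positivity, fun u v j k hj hk => ?_⟩
  have hle := (ofReal_waveNorm_le _ _ _).trans (h u v j k hj hk)
  rw [l2_weightedFourier hs4 (by linarith : θ₀ ≤ 1) u,
    l2_weightedFourier hs2 (by linarith : θ₁ ≤ 1) v] at hle
  have hu : 0 ≤ waveNorm s θ₀ u := waveNorm_nonneg _ _ _
  have hv : 0 ≤ waveNorm s' θ₁ v := waveNorm_nonneg _ _ _
  rw [← ENNReal.ofReal_toReal hC, ← ENNReal.ofReal_mul hu,
    ← ENNReal.ofReal_mul ENNReal.toReal_nonneg,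
    ENNReal.ofReal_le_ofReal_iff (by positivity)] at hle
  have hβ : -e.β = θ₀ - 1 + ε := by
    change -(1 - θ₀ - ε) = _
    ring
  rw [hβ] at hle
  calc _ ≤ C.toReal * (waveNorm s θ₀ u * waveNorm s' θ₁ v) := hle
    _ ≤ (C.toReal + 1) * (waveNorm s θ₀ u * waveNorm s' θ₁ v) := by gcongr; linarith
    _ = _ := (mul_assoc _ _ _).symm

end
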